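/- Let A ⊆ C be an inclusion of C*-algebras such that A is σ-unital and AC is dense in C, and let A^s = A⊗K ⊆ C^s = C⊗K be the stabilized inclusion. Let f_{A^s}: Pic(A^s,C^s) → Pic(A^s) be the homomorphism [X,Y] ↦ [X]. Then: (i) there is an exact sequence 1 → Ker f_{A^s} → Pic(A^s,C^s) → Im f_{A^s} → 1; (ii) Ker f_{A^s} ≅ Aut_I(A^s,C^s)/Int(A^s,C^s); (iii) Im f_{A^s} ≅ Aut(A^s,C^s)/Aut_I(A^s,C^s). -/

import Mathlib

open scoped MultiplierAlgebra

noncomputable section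

structure EquivBimodule (C D Y : Type*)
    [NonUnitalCStarAlgebra C] [PartialOrder C] [StarOrderedRing C]
    [NonUnitalCStarAlgebra D] [PartialOrder D] [StarOrderedRing D]
    [NormedAddCommGroup Y] [NormedSpace ℂ Y] [CompleteSpace Y] : Type _ where
  lsmul : C → Y → Y
  rsmul : Y → D → Y
  linn : Y → Y → C
  rinn : Y → Y → D
  lsmul_add : ∀ c x y, lsmul c (x + y) = lsmul c x + lsmul c y
  add_lsmul : ∀ c c' x, lsmul (c + c') x = lsmul c x + lsmul c' x
  mul_lsmul : ∀ c c' x, lsmul (c * c') x = lsmul c (lsmul c' x)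
  smul_lsmul : ∀ (z : ℂ) c x, lsmul (z • c) x = z • lsmul c x
  lsmul_smul : ∀ (z : ℂ) c x, lsmul c (z • x) = z • lsmul c x
  add_rsmul : ∀ x y d, rsmul (x + y) d = rsmul x d + rsmul y d
  rsmul_add : ∀ x d d', rsmul x (d + d') = rsmul x d + rsmul x d'
  rsmul_mul : ∀ x d d', rsmul x (d * d') = rsmul (rsmul x d) d'
  rsmul_smul : ∀ (z : ℂ) x d, rsmul (z • x) d = z • rsmul x d
  smul_rsmul : ∀ (z : ℂ) x d, rsmul x (z • d) = z • rsmul x d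
  lsmul_rsmul : ∀ c x d, rsmul (lsmul c x) d = lsmul c (rsmul x d)
  linn_add_left : ∀ x y z, linn (x + y) z = linn x z + linn y z
  linn_smul_left : ∀ (t : ℂ) x y, linn (t • x) y = t • linn x y
  linn_star : ∀ x y, star (linn x y) = linn y x
  linn_lsmul_left : ∀ c x y, linn (lsmul c x) y = c * linn x y
  linn_nonneg : ∀ x, 0 ≤ linn x x
  linn_definite : ∀ x, linn x x = 0 → x = 0
  rinn_add_right : ∀ x y z, rinn x (y + z) = rinn x y + rinn x z
  rinn_smul_right : ∀ (t : ℂ) x y, rinn x (t • y) = t • rinn x y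
  rinn_star : ∀ x y, star (rinn x y) = rinn y x
  rinn_rsmul_right : ∀ x y d, rinn x (rsmul y d) = rinn x y * d
  rinn_nonneg : ∀ x, 0 ≤ rinn x x
  rinn_definite : ∀ x, rinn x x = 0 → x = 0
  imprimitivity : ∀ x y z, lsmul (linn x y) z = rsmul x (rinn y z)
  norm_linn : ∀ x, ‖linn x x‖ = ‖x‖ ^ 2
  norm_rinn : ∀ x, ‖rinn x x‖ = ‖x‖ ^ 2
  full_left : Dense (Submodule.span ℂ {c : C | ∃ x y, c = linn x y} : Set C)
  full_right : Dense (Submodule.span ℂ {d : D | ∃ x y, d = rinn x y} : Set D)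

namespace EquivBimodule

variable {C D Y W : Type*}
    [NonUnitalCStarAlgebra C] [PartialOrder C] [StarOrderedRing C]
    [NonUnitalCStarAlgebra D] [PartialOrder D] [StarOrderedRing D]
    [NormedAddCommGroup Y] [NormedSpace ℂ Y] [CompleteSpace Y]
    [NormedAddCommGroup W] [NormedSpace ℂ W] [CompleteSpace W]

structure Iso (E : EquivBimodule C D Y) (F : EquivBimodule C D W) where
  toEquiv : Y ≃ₗ[ℂ] W
  map_lsmul : ∀ c y, toEquiv (E.lsmul c y) = F.lsmul c (toEquiv y)
  map_rsmul : ∀ y d, toEquiv (E.rsmul y d) = F.rsmul (toEquiv y) d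
  map_linn : ∀ x y, F.linn (toEquiv x) (toEquiv y) = E.linn x y
  map_rinn : ∀ x y, F.rinn (toEquiv x) (toEquiv y) = E.rinn x y

end EquivBimodule

def DenseIncl {A C : Type*} [NonUnitalCStarAlgebra C] (ι : A → C) : Prop :=
  Dense (Submodule.span ℂ {x : C | ∃ (a : A) (c : C), x = ι a * c} : Set C)

structure IsMoritaIncl {A B C D Y : Type*}
    [NonUnitalCStarAlgebra C] [PartialOrder C] [StarOrderedRing C]
    [NonUnitalCStarAlgebra D] [PartialOrder D] [StarOrderedRing D]
    [NormedAddCommGroup Y] [NormedSpace ℂ Y] [CompleteSpace Y]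
    (ιA : A → C) (ιB : B → D)
    (E : EquivBimodule C D Y) (X : Submodule ℂ Y) : Prop where
  closed : IsClosed (X : Set Y)
  lsmul_mem : ∀ (a : A), ∀ x ∈ X, E.lsmul (ιA a) x ∈ X
  rsmul_mem : ∀ (b : B), ∀ x ∈ X, E.rsmul x (ιB b) ∈ X
  linn_mem : ∀ x ∈ X, ∀ y ∈ X, E.linn x y ∈ Set.range ιA
  rinn_mem : ∀ x ∈ X, ∀ y ∈ X, E.rinn x y ∈ Set.range ιB
  span_XX_left :
    closure (Submodule.span ℂ {c : C | ∃ x ∈ X, ∃ y ∈ X, c = E.linn x y} : Set C) = Set.range ιA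
  span_YX_left :
    Dense (Submodule.span ℂ {c : C | ∃ (y : Y), ∃ x ∈ X, c = E.linn y x} : Set C)
  span_XX_right :
    closure (Submodule.span ℂ {d : D | ∃ x ∈ X, ∃ y ∈ X, d = E.rinn x y} : Set D) = Set.range ιB
  span_YX_right :
    Dense (Submodule.span ℂ {d : D | ∃ (y : Y), ∃ x ∈ X, d = E.rinn y x} : Set D)

abbrev IsEquiPair {A C Y : Type*}
    [NonUnitalCStarAlgebra C] [PartialOrder C] [StarOrderedRing C]
    [NormedAddCommGroup Y] [NormedSpace ℂ Y] [CompleteSpace Y]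
    (ι : A → C) (E : EquivBimodule C C Y) (X : Submodule ℂ Y) : Prop :=
  IsMoritaIncl ι ι E X

def PairEquiv {C D Y W : Type*}
    [NonUnitalCStarAlgebra C] [PartialOrder C] [StarOrderedRing C]
    [NonUnitalCStarAlgebra D] [PartialOrder D] [StarOrderedRing D]
    [NormedAddCommGroup Y] [NormedSpace ℂ Y] [CompleteSpace Y]
    [NormedAddCommGroup W] [NormedSpace ℂ W] [CompleteSpace W]
    (E : EquivBimodule C D Y) (X : Submodule ℂ Y)
    (F : EquivBimodule C D W) (Z : Submodule ℂ W) : Prop :=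
  ∃ Φ : E.Iso F, X.map Φ.toEquiv.toLinearMap = Z

def IsTrivialData {C : Type*}
    [NonUnitalCStarAlgebra C] [PartialOrder C] [StarOrderedRing C]
    (T : EquivBimodule C C C) : Prop :=
  T.lsmul = (fun c x => c * x) ∧ T.rsmul = (fun x c => x * c) ∧
    T.linn = (fun x y => x * star y) ∧ T.rinn = (fun x y => star x * y)

/-- The data of the equivalence bimodule `Y_σ` induced by an automorphism with
underlying map `σ` (with inverse `σinv`). -/
def IsAlphaData {C : Type*}
    [NonUnitalCStarAlgebra C] [PartialOrder C] [StarOrderedRing C]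
    (σ σinv : C → C) (T : EquivBimodule C C C) : Prop :=
  T.lsmul = (fun c x => c * x) ∧ T.rsmul = (fun x c => x * σ c) ∧
    T.linn = (fun x y => x * star y) ∧ T.rinn = (fun x y => σinv (star x * y))

/-- The submodule `{ι a | a : A}` of `C`, e.g. the subspace `X_α = A` of `Y_α = C`. -/
def rangeSub {A C : Type*} [NonUnitalCStarAlgebra C]
    (ι : A → C) : Submodule ℂ C :=
  Submodule.span ℂ (Set.range ι)

/-- A realization of the interior tensor product `Y ⊗_D W` of equivalence bimodules. -/
structure IsTensorProd {C D L Y W V : Type*}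
    [NonUnitalCStarAlgebra C] [PartialOrder C] [StarOrderedRing C]
    [NonUnitalCStarAlgebra D] [PartialOrder D] [StarOrderedRing D]
    [NonUnitalCStarAlgebra L] [PartialOrder L] [StarOrderedRing L]
    [NormedAddCommGroup Y] [NormedSpace ℂ Y] [CompleteSpace Y]
    [NormedAddCommGroup W] [NormedSpace ℂ W] [CompleteSpace W]
    [NormedAddCommGroup V] [NormedSpace ℂ V] [CompleteSpace V]
    (E : EquivBimodule C D Y) (G : EquivBimodule D L W)
    (F : EquivBimodule C L V) (s : Y → W → V) : Prop where
  add_left : ∀ y y' w, s (y + y') w = s y w + s y' w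
  smul_left : ∀ (z : ℂ) y w, s (z • y) w = z • s y w
  add_right : ∀ y w w', s y (w + w') = s y w + s y w'
  smul_right : ∀ (z : ℂ) y w, s y (z • w) = z • s y w
  balanced : ∀ y d w, s (E.rsmul y d) w = s y (G.lsmul d w)
  map_lsmul : ∀ c y w, F.lsmul c (s y w) = s (E.lsmul c y) w
  map_rsmul : ∀ y w l, F.rsmul (s y w) l = s y (G.rsmul w l)
  map_linn : ∀ y y' w w',
    F.linn (s y w) (s y' w') = E.linn (E.rsmul y (G.linn w w')) y'
  map_rinn : ∀ y y' w w',
    F.rinn (s y w) (s y' w') = G.rinn w (G.lsmul (E.rinn y y') w')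
  dense : Dense (Submodule.span ℂ {v : V | ∃ y w, v = s y w} : Set V)

/-- A realization of the product of two elements of `Equi(A, C)`:
the tensor product bimodule together with the distinguished subspace `X₁ ⊗ X₂`. -/
structure IsPairTensor {A C Y W V : Type*}
    [NonUnitalCStarAlgebra C] [PartialOrder C] [StarOrderedRing C]
    [NormedAddCommGroup Y] [NormedSpace ℂ Y] [CompleteSpace Y]
    [NormedAddCommGroup W] [NormedSpace ℂ W] [CompleteSpace W]
    [NormedAddCommGroup V] [NormedSpace ℂ V] [CompleteSpace V]
    (ι : A → C)
    (E₁ : EquivBimodule C C Y) (X₁ : Submodule ℂ Y)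
    (E₂ : EquivBimodule C C W) (X₂ : Submodule ℂ W)
    (G : EquivBimodule C C V) (XV : Submodule ℂ V) (s : Y → W → V) : Prop where
  tensor : IsTensorProd E₁ E₂ G s
  sub : (XV : Set V) =
    closure (Submodule.span ℂ {v : V | ∃ x ∈ X₁, ∃ z ∈ X₂, v = s x z} : Set V)

section Multiplier

variable {C : Type*} [NonUnitalCStarAlgebra C]

/-- Conjugation `c ↦ u c u*` by a (unitary) multiplier `u ∈ M(C)`. -/
def mAd (u : 𝓜(ℂ, C)) (c : C) : C := u.fst ((star u).snd c)

/-- `m ∈ M(C)` is (the extension of) a multiplier of the subalgebra `A` (realized by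
`ι : A → C`): it maps `A` into `A` on both sides.  When `AC` is dense in `C`, the
multiplier algebra `M(A)` is exactly the set of such multipliers. -/
def IsMultiplierOf {A : Type*} (ι : A → C) (m : 𝓜(ℂ, C)) : Prop :=
  (∀ a : A, m.fst (ι a) ∈ Set.range ι) ∧ (∀ a : A, m.snd (ι a) ∈ Set.range ι)

/-- `u ∈ K(M(C))`: a unitary multiplier with `u a u*, u* a u ∈ A` for all `a ∈ A`. -/
def mem_KMC {A : Type*} (ι : A → C) (u : 𝓜(ℂ, C)) : Prop :=
  u ∈ unitary 𝓜(ℂ, C) ∧ (∀ a : A, mAd u (ι a) ∈ Set.range ι) ∧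
    (∀ a : A, mAd (star u) (ι a) ∈ Set.range ι)

/-- The subspace `Au = {a u | a ∈ A}` of `C`, for a multiplier `u ∈ M(C)`. -/
def AuSub {A : Type*} (ι : A → C) (u : 𝓜(ℂ, C)) : Submodule ℂ C :=
  Submodule.span ℂ {x : C | ∃ a : A, x = u.snd (ι a)}

end Multiplier

/-- A positive element `h` with `hA` dense in `A`; a C*-algebra is σ-unital iff it
possesses such a (strictly positive) element. -/
def SigmaUnital (A : Type*) [NonUnitalCStarAlgebra A] [PartialOrder A]
    [StarOrderedRing A] : Prop :=
  ∃ h : A, 0 ≤ h ∧ Dense (Set.range fun a : A => h * a)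

/-- A system of matrix units over `C` realizing `Cs` as the stabilization `C ⊗ K`. -/
structure IsStabilization {C Cs : Type*} [NonUnitalCStarAlgebra C]
    [NonUnitalCStarAlgebra Cs] (e : ℕ → ℕ → C → Cs) : Prop where
  map_add : ∀ i j c c', e i j (c + c') = e i j c + e i j c'
  map_smul : ∀ i j (z : ℂ) c, e i j (z • c) = z • e i j c
  map_mul : ∀ i j k l c d, e i j c * e k l d = if j = k then e i l (c * d) else 0
  map_star : ∀ i j c, star (e i j c) = e j i (star c)
  isometry : ∀ i j c, ‖e i j c‖ = ‖c‖
  dense : Dense (Submodule.span ℂ {x : Cs | ∃ i j c, x = e i j c} : Set Cs)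

section Unital

variable {A B C D : Type*} [CStarAlgebra A] [CStarAlgebra B] [CStarAlgebra C] [CStarAlgebra D]
  [PartialOrder C] [StarOrderedRing C] [PartialOrder D] [StarOrderedRing D]

/-- A conditional expectation from `C` onto `A`, for a unital inclusion realized by
`ι : A →⋆ₐ[ℂ] C`. -/
structure CondExpectation [PartialOrder A] [StarOrderedRing A] (ι : A →⋆ₐ[ℂ] C) where
  toFun : C → A
  map_add : ∀ x y, toFun (x + y) = toFun x + toFun y
  map_smul : ∀ (z : ℂ) x, toFun (z • x) = z • toFun x
  map_star : ∀ x, toFun (star x) = star (toFun x)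
  retraction : ∀ a, toFun (ι a) = a
  left_mod : ∀ a c, toFun (ι a * c) = a * toFun c
  right_mod : ∀ c a, toFun (c * ι a) = toFun c * a
  pos : ∀ c, 0 ≤ toFun (star c * c)

/-- A quasi-basis for a conditional expectation, in the sense of Watatani. -/
def IsQuasiBasis [PartialOrder A] [StarOrderedRing A] {ι : A →⋆ₐ[ℂ] C}
    (E : CondExpectation ι) {n : ℕ} (u : Fin n → C) : Prop :=
  ∀ c : C, (∑ i, u i * ι (E.toFun (star (u i) * c)) = c) ∧
    (∑ i, ι (E.toFun (c * u i)) * star (u i) = c)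

/-- A conditional expectation is of Watatani index-finite type if it admits a
quasi-basis. -/
def FiniteIndex [PartialOrder A] [StarOrderedRing A] {ι : A →⋆ₐ[ℂ] C}
    (E : CondExpectation ι) : Prop :=
  ∃ (n : ℕ) (u : Fin n → C), IsQuasiBasis E u

/-- `A' ∩ C = ℂ 1` for the inclusion realized by `ι`. -/
def IrreducibleIncl (ι : A →⋆ₐ[ℂ] C) : Prop :=
  ∀ c : C, (∀ a : A, ι a * c = c * ι a) → ∃ z : ℂ, c = z • (1 : C)

variable [PartialOrder A] [StarOrderedRing A] [PartialOrder B] [StarOrderedRing B]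

/-- A conditional expectation `E^X : Y → X` with respect to `E^A` and `E^B`
(Definition 2.4 of [KT4]). -/
structure IsBimodCondExp {Y : Type*}
    [NormedAddCommGroup Y] [NormedSpace ℂ Y] [CompleteSpace Y]
    (ιA : A →⋆ₐ[ℂ] C) (ιB : B →⋆ₐ[ℂ] D)
    (EA : CondExpectation ιA) (EB : CondExpectation ιB)
    (EY : EquivBimodule C D Y) (X : Submodule ℂ Y) (EX : Y → Y) : Prop where
  map_add : ∀ y y', EX (y + y') = EX y + EX y'
  map_smul : ∀ (z : ℂ) y, EX (z • y) = z • EX y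
  mem : ∀ y, EX y ∈ X
  cond1 : ∀ (c : C), ∀ x ∈ X, EX (EY.lsmul c x) = EY.lsmul (ιA (EA.toFun c)) x
  cond2 : ∀ (a : A) (y : Y), EX (EY.lsmul (ιA a) y) = EY.lsmul (ιA a) (EX y)
  cond3 : ∀ (y : Y), ∀ x ∈ X, ιA (EA.toFun (EY.linn y x)) = EY.linn (EX y) x
  cond4 : ∀ (d : D), ∀ x ∈ X, EX (EY.rsmul x d) = EY.rsmul x (ιB (EB.toFun d))
  cond5 : ∀ (b : B) (y : Y), EX (EY.rsmul y (ιB b)) = EY.rsmul (EX y) (ιB b)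
  cond6 : ∀ (y : Y), ∀ x ∈ X, ιB (EB.toFun (EY.rinn y x)) = EY.rinn (EX y) x

/-- The C*-basic construction `C₁` for a conditional expectation `E : C → A`,
realized by a unital embedding `ιC : C →⋆ₐ[ℂ] C₁` and the Jones projection `e`. -/
structure IsBasicConstruction {A C C₁ : Type*} [CStarAlgebra A] [CStarAlgebra C]
    [CStarAlgebra C₁] [PartialOrder A] [StarOrderedRing A]
    [PartialOrder C] [StarOrderedRing C]
    (ι : A →⋆ₐ[ℂ] C) (E : CondExpectation ι)
    (ιC : C →⋆ₐ[ℂ] C₁) (e : C₁) : Prop where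
  inj : Function.Injective ιC
  idem : e * e = e
  selfadj : star e = e
  comm : ∀ a : A, ιC (ι a) * e = e * ιC (ι a)
  expect : ∀ c : C, e * ιC c * e = ιC (ι (E.toFun c)) * e
  faithful : ∀ c : C, ιC c * e = 0 → c = 0
  span : ∀ x : C₁, x ∈ Submodule.span ℂ {z : C₁ | ∃ c d : C, z = ιC c * e * ιC d}

end Unital

/-- `M` is the `A–B`-equivalence bimodule obtained by restricting the operations of the
`C–D`-equivalence bimodule `EY` to the closed subspace `X` (whose inner products on `X`
take values in the subalgebras realized by `ιA`, `ιB`). -/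
structure IsRestriction {A B C D Y : Type*}
    [NonUnitalCStarAlgebra A] [PartialOrder A] [StarOrderedRing A]
    [NonUnitalCStarAlgebra B] [PartialOrder B] [StarOrderedRing B]
    [NonUnitalCStarAlgebra C] [PartialOrder C] [StarOrderedRing C]
    [NonUnitalCStarAlgebra D] [PartialOrder D] [StarOrderedRing D]
    [NormedAddCommGroup Y] [NormedSpace ℂ Y] [CompleteSpace Y]
    (ιA : A → C) (ιB : B → D)
    (EY : EquivBimodule C D Y) (X : Submodule ℂ Y) [CompleteSpace X]
    (M : EquivBimodule A B X) : Prop where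
  lsmul_coe : ∀ (a : A) (x : X), (M.lsmul a x : Y) = EY.lsmul (ιA a) (x : Y)
  rsmul_coe : ∀ (x : X) (b : B), (M.rsmul x b : Y) = EY.rsmul (x : Y) (ιB b)
  linn_coe : ∀ x y : X, ιA (M.linn x y) = EY.linn (x : Y) (y : Y)
  rinn_coe : ∀ x y : X, ιB (M.rinn x y) = EY.rinn (x : Y) (y : Y)

section Upward

variable {A B C D C₁ D₁ : Type*} [CStarAlgebra A] [CStarAlgebra B] [CStarAlgebra C]
  [CStarAlgebra D] [CStarAlgebra C₁] [CStarAlgebra D₁]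
  [PartialOrder A] [StarOrderedRing A] [PartialOrder B] [StarOrderedRing B]
  [PartialOrder C] [StarOrderedRing C] [PartialOrder D] [StarOrderedRing D]
  [PartialOrder C₁] [StarOrderedRing C₁] [PartialOrder D₁] [StarOrderedRing D₁]

/-- A realization of the upward basic construction `C ⊗_A X ⊗_B D̃` as a
`C₁–D₁`-equivalence bimodule, where `M` is the middle `A–B`-equivalence bimodule
(`X` regarded as an `A–B`-bimodule), together with the canonical trilinear map `t`
(the map `(c, x, d) ↦ c ⊗ x ⊗ d̃`, conjugate-linear in the last variable). -/
structure IsUpwardBasic {Xc T : Type*}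
    [NormedAddCommGroup Xc] [NormedSpace ℂ Xc] [CompleteSpace Xc]
    [NormedAddCommGroup T] [NormedSpace ℂ T] [CompleteSpace T]
    (ιA : A →⋆ₐ[ℂ] C) (ιB : B →⋆ₐ[ℂ] D)
    (EA : CondExpectation ιA) (EB : CondExpectation ιB)
    (M : EquivBimodule A B Xc)
    (ιC : C →⋆ₐ[ℂ] C₁) (eA : C₁) (ιD : D →⋆ₐ[ℂ] D₁) (eB : D₁)
    (F : EquivBimodule C₁ D₁ T) (t : C → Xc → D → T) : Prop where
  add₁ : ∀ c c' x d, t (c + c') x d = t c x d + t c' x d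
  smul₁ : ∀ (z : ℂ) c x d, t (z • c) x d = z • t c x d
  add₂ : ∀ c x x' d, t c (x + x') d = t c x d + t c x' d
  smul₂ : ∀ (z : ℂ) c x d, t c (z • x) d = z • t c x d
  add₃ : ∀ c x d d', t c x (d + d') = t c x d + t c x d'
  smul₃ : ∀ (z : ℂ) c x d, t c x (z • d) = (starRingEnd ℂ z) • t c x d
  balanced₁ : ∀ (a : A) c x d, t (c * ιA a) x d = t c (M.lsmul a x) d
  balanced₂ : ∀ (b : B) c x d, t c (M.rsmul x b) d = t c x (d * ιB (star b))
  map_lsmul : ∀ c' c x d, F.lsmul (ιC c') (t c x d) = t (c' * c) x d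
  map_eA : ∀ c x d, F.lsmul eA (t c x d) = t (ιA (EA.toFun c)) x d
  map_rsmul : ∀ c x d d', F.rsmul (t c x d) (ιD d') = t c x (star d' * d)
  map_eB : ∀ c x d, F.rsmul (t c x d) eB = t c x (ιB (EB.toFun d))
  linn_eq : ∀ c c' x x' d d',
    F.linn (t c x d) (t c' x' d') =
      ιC (c * ιA (M.linn (M.rsmul x (EB.toFun (star d * d'))) x')) * eA * ιC (star c')
  rinn_eq : ∀ c c' x x' d d',
    F.rinn (t c x d) (t c' x' d') =
      ιD d * eB * ιD (ιB (M.rinn x (M.lsmul (EA.toFun (star c * c')) x')) * star d')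
  dense : Dense (Submodule.span ℂ {v : T | ∃ c x d, v = t c x d} : Set T)

end Upward



namespace EquivBimodule

section Basics

variable {C D Y : Type*}
    [NonUnitalCStarAlgebra C] [PartialOrder C] [StarOrderedRing C]
    [NonUnitalCStarAlgebra D] [PartialOrder D] [StarOrderedRing D]
    [NormedAddCommGroup Y] [NormedSpace ℂ Y] [CompleteSpace Y]
    (E : EquivBimodule C D Y)

lemma linn_add_right (x y z : Y) : E.linn x (y + z) = E.linn x y + E.linn x z := by
  rw [← E.linn_star, E.linn_add_left, star_add, E.linn_star, E.linn_star]

lemma linn_smul_right (t : ℂ) (x y : Y) : E.linn x (t • y) = star t • E.linn x y := by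
  rw [← E.linn_star, E.linn_smul_left, star_smul, E.linn_star]

lemma linn_lsmul_right (c : C) (x y : Y) : E.linn x (E.lsmul c y) = E.linn x y * star c := by
  rw [← E.linn_star, E.linn_lsmul_left, star_mul, E.linn_star]

lemma rinn_add_left (x y z : Y) : E.rinn (x + y) z = E.rinn x z + E.rinn y z := by
  rw [← E.rinn_star, E.rinn_add_right, star_add, E.rinn_star, E.rinn_star]

lemma rinn_smul_left (t : ℂ) (x y : Y) : E.rinn (t • x) y = star t • E.rinn x y := by
  rw [← E.rinn_star, E.rinn_smul_right, star_smul, E.rinn_star]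

lemma rinn_rsmul_left (d : D) (x y : Y) : E.rinn (E.rsmul x d) y = star d * E.rinn x y := by
  rw [← E.rinn_star, E.rinn_rsmul_right, star_mul, E.rinn_star]

/-- Left action as a bilinear map. -/
def lL : C →ₗ[ℂ] Y →ₗ[ℂ] Y :=
  LinearMap.mk₂ ℂ E.lsmul E.add_lsmul E.smul_lsmul E.lsmul_add E.lsmul_smul

/-- Right action as a bilinear map. -/
def rL : D →ₗ[ℂ] Y →ₗ[ℂ] Y :=
  LinearMap.mk₂ ℂ (fun d y => E.rsmul y d) (fun d d' y => E.rsmul_add y d d')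
    (fun z d y => E.smul_rsmul z y d) (fun d x y => E.add_rsmul x y d)
    (fun z d y => E.rsmul_smul z y d)

/-- Left inner product, linear in the first variable. -/
def lI (y : Y) : Y →ₗ[ℂ] C where
  toFun x := E.linn x y
  map_add' x x' := E.linn_add_left x x' y
  map_smul' z x := E.linn_smul_left z x y

/-- Right inner product, linear in the second variable. -/
def rI (x : Y) : Y →ₗ[ℂ] D where
  toFun y := E.rinn x y
  map_add' y y' := E.rinn_add_right x y y'
  map_smul' z y := E.rinn_smul_right z x y

@[simp] lemma lL_apply (c : C) (y : Y) : E.lL c y = E.lsmul c y := rfl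
@[simp] lemma rL_apply (d : D) (y : Y) : E.rL d y = E.rsmul y d := rfl
@[simp] lemma lI_apply (x y : Y) : E.lI y x = E.linn x y := rfl
@[simp] lemma rI_apply (x y : Y) : E.rI x y = E.rinn x y := rfl

lemma norm_lsmul_le (c : C) (y : Y) : ‖E.lsmul c y‖ ≤ ‖c‖ * ‖y‖ := by
  refine le_of_sq_le_sq ?_ (by positivity)
  rw [← E.norm_linn, E.linn_lsmul_left, E.linn_lsmul_right]
  calc ‖c * (E.linn y y * star c)‖ ≤ ‖c‖ * (‖E.linn y y‖ * ‖star c‖) :=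
        (norm_mul_le _ _).trans (by gcongr; exact norm_mul_le _ _)
    _ = (‖c‖ * ‖y‖) ^ 2 := by rw [E.norm_linn, norm_star]; ring

lemma norm_rsmul_le (y : Y) (d : D) : ‖E.rsmul y d‖ ≤ ‖d‖ * ‖y‖ := by
  refine le_of_sq_le_sq ?_ (by positivity)
  rw [← E.norm_rinn, E.rinn_rsmul_left, E.rinn_rsmul_right]
  calc ‖star d * (E.rinn y y * d)‖ ≤ ‖star d‖ * (‖E.rinn y y‖ * ‖d‖) :=
        (norm_mul_le _ _).trans (by gcongr; exact norm_mul_le _ _)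
    _ = (‖d‖ * ‖y‖) ^ 2 := by rw [E.norm_rinn, norm_star]; ring

lemma polar_bound {M : Type*} [NormedAddCommGroup M] [NormedSpace ℂ M] (q : Y → Y → M)
    (h1 : ∀ x y z, q (x + y) z = q x z + q y z) (h2 : ∀ x y z, q x (y + z) = q x y + q x z)
    (h3 : ∀ (t : ℂ) x y, q (t • x) y = t • q x y)
    (h4 : ∀ (t : ℂ) x y, q x (t • y) = star t • q x y)
    (hn : ∀ x, ‖q x x‖ = ‖x‖ ^ 2) (x y : Y) : ‖q x y‖ ≤ (1 + ‖y‖) ^ 2 * ‖x‖ := by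
  have key : ∀ x y : Y, ‖q x y‖ ≤ (‖x‖ + ‖y‖) ^ 2 := by
    intro x y
    have e : (4 : ℂ) • q x y = q (x + y) (x + y) - q (x + (-1 : ℂ) • y) (x + (-1 : ℂ) • y)
        + Complex.I • (q (x + Complex.I • y) (x + Complex.I • y)
          - q (x + (-Complex.I) • y) (x + (-Complex.I) • y)) := by
      simp only [h1, h2, h3, h4, smul_add, smul_sub, smul_smul]
      simp
      module
    have b : ∀ t : ℂ, ‖t‖ = 1 → ‖q (x + t • y) (x + t • y)‖ ≤ (‖x‖ + ‖y‖) ^ 2 := by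
      intro t ht
      rw [hn]
      gcongr
      refine (norm_add_le _ _).trans ?_
      rw [norm_smul, ht, one_mul]
    have h4' : 4 * ‖q x y‖ = ‖(4 : ℂ) • q x y‖ := by rw [norm_smul]; simp
    have b1 := b 1 (by simp)
    rw [one_smul] at b1
    have b2 := b (-1) (by simp)
    have b3 := b Complex.I (by simp)
    have b4 := b (-Complex.I) (by simp)
    have : ‖(4 : ℂ) • q x y‖ ≤ ((‖x‖ + ‖y‖) ^ 2 + (‖x‖ + ‖y‖) ^ 2)
        + ((‖x‖ + ‖y‖) ^ 2 + (‖x‖ + ‖y‖) ^ 2) := by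
      rw [e]
      refine (norm_add_le _ _).trans (add_le_add ?_ ?_)
      · exact (norm_sub_le _ _).trans (add_le_add b1 b2)
      · rw [norm_smul, Complex.norm_I, one_mul]
        exact (norm_sub_le _ _).trans (add_le_add b3 b4)
    linarith
  by_cases hx : x = 0
  · subst hx
    have : q 0 y = 0 := by simpa using h3 0 0 y
    simp [this]
  have hx' : ‖x‖ ≠ 0 := by simpa using hx
  have e : q x y = (‖x‖ : ℂ) • q ((‖x‖ : ℂ)⁻¹ • x) y := by
    rw [h3, smul_smul, mul_inv_cancel₀ (by exact_mod_cast hx'), one_smul]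
  rw [e, norm_smul, mul_comm]
  have := key ((‖x‖ : ℂ)⁻¹ • x) y
  rw [norm_smul, norm_inv] at this
  simp only [Complex.norm_real, norm_norm, inv_mul_cancel₀ hx'] at this ⊢
  gcongr

lemma continuous_lL (c : C) : Continuous (E.lL c) :=
  AddMonoidHomClass.continuous_of_bound (E.lL c) ‖c‖ (fun y => E.norm_lsmul_le c y)

lemma continuous_rL (d : D) : Continuous (E.rL d) :=
  AddMonoidHomClass.continuous_of_bound (E.rL d) ‖d‖ (fun y => E.norm_rsmul_le y d)

lemma continuous_lL_flip (y : Y) : Continuous (E.lL.flip y) :=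
  AddMonoidHomClass.continuous_of_bound (E.lL.flip y) ‖y‖
    (fun c => by simpa [mul_comm] using E.norm_lsmul_le c y)

lemma continuous_rL_flip (y : Y) : Continuous (E.rL.flip y) :=
  AddMonoidHomClass.continuous_of_bound (E.rL.flip y) ‖y‖
    (fun c => by simpa [mul_comm] using E.norm_rsmul_le y c)

lemma continuous_lI (y : Y) : Continuous (E.lI y) :=
  AddMonoidHomClass.continuous_of_bound (E.lI y) ((1 + ‖y‖) ^ 2)
    (fun x => polar_bound E.linn E.linn_add_left E.linn_add_right E.linn_smul_left
      E.linn_smul_right E.norm_linn x y)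

lemma continuous_rI (x : Y) : Continuous (E.rI x) :=
  AddMonoidHomClass.continuous_of_bound (E.rI x) ((1 + ‖x‖) ^ 2)
    (fun y => polar_bound (fun a b => E.rinn b a) (fun a b c => E.rinn_add_right c a b)
      (fun a b c => E.rinn_add_left b c a) (fun t a b => E.rinn_smul_right t b a)
      (fun t a b => E.rinn_smul_left t b a) E.norm_rinn y x)

lemma continuous_lsmul (c : C) : Continuous (fun y => E.lsmul c y) := E.continuous_lL c
lemma continuous_rsmul (d : D) : Continuous (fun y => E.rsmul y d) := E.continuous_rL d
lemma continuous_lsmul' (y : Y) : Continuous (fun c => E.lsmul c y) := E.continuous_lL_flip y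
lemma continuous_rsmul' (y : Y) : Continuous (fun d => E.rsmul y d) := E.continuous_rL_flip y
lemma continuous_linn (y : Y) : Continuous (fun x => E.linn x y) := E.continuous_lI y
lemma continuous_rinn (x : Y) : Continuous (fun y => E.rinn x y) := E.continuous_rI x
lemma continuous_linn' (x : Y) : Continuous (fun y => E.linn x y) := by
  simpa only [Function.comp_def, E.linn_star] using continuous_star.comp (E.continuous_linn x)
lemma continuous_rinn' (y : Y) : Continuous (fun x => E.rinn x y) := by
  simpa only [Function.comp_def, E.rinn_star] using continuous_star.comp (E.continuous_rinn y)

/-- Induction principle for closed linear predicates. -/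
lemma dense_span_induction {V : Type*} [NormedAddCommGroup V] [NormedSpace ℂ V] {S : Set V}
    (hS : Dense (Submodule.span ℂ S : Set V)) (Z : Submodule ℂ V) (hZ : IsClosed (Z : Set V))
    (h : S ⊆ Z) (v : V) : v ∈ Z := by
  have h1 : (Submodule.span ℂ S : Set V) ⊆ Z := Submodule.span_le.2 h
  have h2 := closure_minimal h1 hZ
  rw [hS.closure_eq] at h2
  exact h2 trivial

lemma eq_of_dense_span {V M : Type*} [NormedAddCommGroup V] [NormedSpace ℂ V]
    [NormedAddCommGroup M] [NormedSpace ℂ M] {S : Set V}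
    (hS : Dense (Submodule.span ℂ S : Set V)) (f g : V →ₗ[ℂ] M) (hf : Continuous f)
    (hg : Continuous g) (h : ∀ s ∈ S, f s = g s) (v : V) : f v = g v :=
  dense_span_induction hS (LinearMap.eqLocus f g) (isClosed_eq hf hg) h v

lemma linn_rsmul (x y : Y) (d : D) :
    E.linn (E.rsmul x d) y = E.linn x (E.rsmul y (star d)) := by
  have hg : Continuous (fun d => star (E.linn (E.rsmul y (star d)) x)) :=
    continuous_star.comp ((E.continuous_linn x).comp
      ((E.continuous_rsmul' y).comp continuous_star))
  let g : D →ₗ[ℂ] C :=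
    { toFun := fun d => star (E.linn (E.rsmul y (star d)) x)
      map_add' := fun a b => by simp [star_add, E.rsmul_add, E.linn_add_left]
      map_smul' := fun z b => by simp [star_smul, E.smul_rsmul, E.linn_smul_left] }
  have := eq_of_dense_span E.full_right (E.lI y ∘ₗ E.rL.flip x) g
    ((E.continuous_lI y).comp (E.continuous_rL_flip x)) hg ?_ d
  · simpa [g, E.linn_star] using this
  · rintro _ ⟨u, v, rfl⟩
    simp [g, E.linn_star, E.rinn_star, ← E.imprimitivity, E.linn_lsmul_left, E.linn_lsmul_right]

lemma dense_approx {A : Type*} [NonUnitalCStarAlgebra A] [PartialOrder A] [StarOrderedRing A]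
    (a : A) (ε : ℝ) (hε : 0 < ε) : ∃ c : A, ‖c‖ ≤ 1 ∧ star c = c ∧ ‖a - c * a‖ < ε := by
  have hu := CStarAlgebra.increasingApproximateUnit A
  have h1 := (hu.tendsto_mul_right a).eventually (Metric.ball_mem_nhds a hε)
  obtain ⟨c, hc, hc1, hc2⟩ := (h1.and (hu.eventually_norm.and hu.eventually_star_eq)).exists
  refine ⟨c, hc1, hc2, ?_⟩
  simpa [dist_eq_norm, norm_sub_rev] using hc

lemma left_approx (y : Y) (ε : ℝ) (hε : 0 < ε) : ∃ c : C, ‖y - E.lsmul c y‖ < ε := by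
  obtain ⟨c, hc, hcs, h⟩ := dense_approx (E.linn y y) (ε ^ 2 / 2) (by positivity)
  refine ⟨c, lt_of_pow_lt_pow_left₀ 2 hε.le ?_⟩
  have e : E.linn (y - E.lsmul c y) (y - E.lsmul c y) =
      (E.linn y y - c * E.linn y y) - (E.linn y y - c * E.linn y y) * c := by
    rw [sub_eq_add_neg, ← neg_one_smul ℂ (E.lsmul c y)]
    simp only [E.linn_add_left, E.linn_add_right, E.linn_smul_left, E.linn_smul_right,
      E.linn_lsmul_left, E.linn_lsmul_right, hcs]
    simp [sub_mul, mul_assoc]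
    abel
  rw [← E.norm_linn, e]
  have h2 : ‖(E.linn y y - c * E.linn y y) * c‖ ≤ ‖E.linn y y - c * E.linn y y‖ * 1 :=
    (norm_mul_le _ _).trans (by gcongr)
  have := norm_sub_le (E.linn y y - c * E.linn y y) ((E.linn y y - c * E.linn y y) * c)
  linarith

lemma right_approx (y : Y) (ε : ℝ) (hε : 0 < ε) : ∃ c : D, ‖y - E.rsmul y c‖ < ε := by
  obtain ⟨c, hc, hcs, h⟩ := dense_approx (E.rinn y y) (ε ^ 2 / 2) (by positivity)
  refine ⟨c, lt_of_pow_lt_pow_left₀ 2 hε.le ?_⟩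
  have e : E.rinn (y - E.rsmul y c) (y - E.rsmul y c) =
      (E.rinn y y - c * E.rinn y y) - (E.rinn y y - c * E.rinn y y) * c := by
    rw [sub_eq_add_neg, ← neg_one_smul ℂ (E.rsmul y c)]
    simp only [E.rinn_add_left, E.rinn_add_right, E.rinn_smul_left, E.rinn_smul_right,
      E.rinn_rsmul_left, E.rinn_rsmul_right, hcs]
    simp [sub_mul, mul_assoc]
    abel
  rw [← E.norm_rinn, e]
  have h2 : ‖(E.rinn y y - c * E.rinn y y) * c‖ ≤ ‖E.rinn y y - c * E.rinn y y‖ * 1 :=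
    (norm_mul_le _ _).trans (by gcongr)
  have := norm_sub_le (E.rinn y y - c * E.rinn y y) ((E.rinn y y - c * E.rinn y y) * c)
  linarith

/-- A closed subspace containing `G • Y`, where `G` spans a dense subspace, is everything. -/
lemma left_total {G : Set C} (hG : Dense (Submodule.span ℂ G : Set C)) (Z : Submodule ℂ Y)
    (hZ : IsClosed (Z : Set Y)) (h : ∀ g ∈ G, ∀ y, E.lsmul g y ∈ Z) (y : Y) : y ∈ Z := by
  have h1 : ∀ c : C, E.lsmul c y ∈ Z := fun c =>
    dense_span_induction hG (Z.comap (E.lL.flip y)) (hZ.preimage (E.continuous_lL_flip y))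
      (fun g hg => h g hg y) c
  have : y ∈ closure (Z : Set Y) := Metric.mem_closure_iff.2 fun ε hε => by
    obtain ⟨c, hc⟩ := E.left_approx y ε hε
    exact ⟨_, h1 c, by rwa [dist_eq_norm]⟩
  rwa [hZ.closure_eq] at this

lemma right_total {G : Set D} (hG : Dense (Submodule.span ℂ G : Set D)) (Z : Submodule ℂ Y)
    (hZ : IsClosed (Z : Set Y)) (h : ∀ g ∈ G, ∀ y, E.rsmul y g ∈ Z) (y : Y) : y ∈ Z := by
  have h1 : ∀ c : D, E.rsmul y c ∈ Z := fun c =>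
    dense_span_induction hG (Z.comap (E.rL.flip y)) (hZ.preimage (E.continuous_rL_flip y))
      (fun g hg => h g hg y) c
  have : y ∈ closure (Z : Set Y) := Metric.mem_closure_iff.2 fun ε hε => by
    obtain ⟨c, hc⟩ := E.right_approx y ε hε
    exact ⟨_, h1 c, by rwa [dist_eq_norm]⟩
  rwa [hZ.closure_eq] at this

end Basics

end EquivBimodule

open EquivBimodule in
/-- Genericity: with a countable system of matrix units acting on `X`, the set of vectors `t`
such that `x` is almost in the orbit of `t` is dense. -/
lemma generic_dense {X B A : Type*} [NormedAddCommGroup X] [NormedSpace ℂ X]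
    [AddCommGroup B] [Module ℂ B] [TopologicalSpace A]
    (act : B →ₗ[ℂ] X →ₗ[ℂ] X) (E : ℕ → ℕ → A → B) (h : A) (m : A → A) (hm : DenseRange m)
    (hE : ∀ i j k l a y, act (E i j h) (act (E k l a) y) =
      if j = k then act (E i l (m a)) y else 0)
    (hcont : ∀ i j y, Continuous fun a => act (E i j a) y)
    (hdense : Dense (Submodule.span ℂ {x : X | ∃ i j a y, x = act (E i j a) y} : Set X))
    (x : X) (ε : ℝ) (hε : 0 < ε) : Dense {t : X | ∃ b, ‖x - act b t‖ < ε} := by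
  let rows : ℕ → ℕ → Submodule ℂ X := fun N M =>
    Submodule.span ℂ {x : X | ∃ i j a y, N ≤ i ∧ i < M ∧ x = act (E i j a) y}
  let cols : ℕ → ℕ → Submodule ℂ B := fun N M =>
    Submodule.span ℂ {b : B | ∃ i j, N ≤ j ∧ j < M ∧ b = E i j h}
  have rows_mono : ∀ N N' M M', N' ≤ N → M ≤ M' → rows N M ≤ rows N' M' := by
    intro N N' M M' h1 h2
    refine Submodule.span_mono ?_
    rintro _ ⟨i, j, a, y, h3, h4, rfl⟩
    exact ⟨i, j, a, y, h1.trans h3, h4.trans_le h2, rfl⟩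
  have cols_mono : ∀ N N' M M', N' ≤ N → M ≤ M' → cols N M ≤ cols N' M' := by
    intro N N' M M' h1 h2
    refine Submodule.span_mono ?_
    rintro _ ⟨i, j, h3, h4, rfl⟩
    exact ⟨i, j, h1.trans h3, h4.trans_le h2, rfl⟩
  have kill : ∀ N M N' M', (M ≤ N' ∨ M' ≤ N) → ∀ b ∈ cols N M, ∀ w ∈ rows N' M',
      act b w = 0 := by
    intro N M N' M' hd b hb w hw
    induction hb using Submodule.span_induction with
    | zero => simp
    | add b b' _ _ hb hb' => simp [hb, hb']
    | smul z b _ hb => simp [hb]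
    | mem b hb =>
      obtain ⟨i, j, h1, h2, rfl⟩ := hb
      induction hw using Submodule.span_induction with
      | zero => simp
      | add b b' _ _ hb hb' => simp [hb, hb']
      | smul z b _ hb => simp [hb]
      | mem w hw =>
        obtain ⟨k, l, a, y, h3, h4, rfl⟩ := hw
        rw [hE, if_neg (by omega)]
  have claim2 : ∀ x ∈ Submodule.span ℂ {x : X | ∃ i l a y, x = act (E i l (m a)) y},
      ∀ N, ∃ M, N ≤ M ∧ ∃ b ∈ cols N M, ∃ w ∈ rows N M, act b w = x := by
    intro x hx
    induction hx using Submodule.span_induction with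
    | zero => exact fun N => ⟨N, le_rfl, 0, zero_mem _, 0, zero_mem _, by simp⟩
    | mem x hx =>
      obtain ⟨i, l, a, y, rfl⟩ := hx
      intro N
      refine ⟨N + 1, by omega, E i N h, Submodule.subset_span ⟨i, N, by omega, by omega, rfl⟩,
        act (E N l a) y, Submodule.subset_span ⟨N, l, a, y, by omega, by omega, rfl⟩, ?_⟩
      rw [hE, if_pos rfl]
    | smul z x _ hx =>
      intro N
      obtain ⟨M, hM, b, hb, w, hw, hx⟩ := hx N
      exact ⟨M, hM, b, hb, z • w, Submodule.smul_mem _ _ hw, by simp [hx]⟩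
    | add x x' _ _ hx hx' =>
      intro N
      obtain ⟨M, hM, b, hb, w, hw, hx⟩ := hx N
      obtain ⟨M', hM', b', hb', w', hw', hx'⟩ := hx' M
      refine ⟨M', hM.trans hM', b + b', add_mem (cols_mono N N M M' le_rfl hM' hb)
        (cols_mono M N M' M' hM le_rfl hb'), w + w',
        add_mem (rows_mono N N M M' le_rfl hM' hw) (rows_mono M N M' M' hM le_rfl hw'), ?_⟩
      simp [hx, hx', kill N M M M' (Or.inl le_rfl) b hb w' hw',
        kill M M' N M (Or.inr le_rfl) b' hb' w hw]
  have claim3 : ∀ x ∈ Submodule.span ℂ {x : X | ∃ i j a y, x = act (E i j a) y},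
      ∃ N, x ∈ rows 0 N := by
    intro x hx
    induction hx using Submodule.span_induction with
    | zero => exact ⟨0, zero_mem _⟩
    | mem x hx =>
      obtain ⟨i, l, a, y, rfl⟩ := hx
      exact ⟨i + 1, Submodule.subset_span ⟨i, l, a, y, by omega, by omega, rfl⟩⟩
    | smul z x _ hx =>
      obtain ⟨N, hN⟩ := hx
      exact ⟨N, Submodule.smul_mem _ _ hN⟩
    | add x x' _ _ hx hx' =>
      obtain ⟨N, hN⟩ := hx
      obtain ⟨N', hN'⟩ := hx'
      exact ⟨max N N', add_mem (rows_mono 0 0 N _ le_rfl (le_max_left _ _) hN)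
        (rows_mono 0 0 N' _ le_rfl (le_max_right _ _) hN')⟩
  have hdense2 : Dense (Submodule.span ℂ {x : X | ∃ i l a y, x = act (E i l (m a)) y} : Set X) := by
    intro x
    refine dense_span_induction hdense
      (Submodule.span ℂ {x : X | ∃ i l a y, x = act (E i l (m a)) y}).topologicalClosure
      (Submodule.isClosed_topologicalClosure _) ?_ x
    rintro _ ⟨i, j, a, y, rfl⟩
    refine hm.induction_on (p := fun a => act (E i j a) y ∈
      (Submodule.span ℂ {x : X | ∃ i l a y, x = act (E i l (m a)) y}).topologicalClosure) a ?_ ?_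
    · exact (Submodule.isClosed_topologicalClosure _).preimage (hcont i j y)
    · intro a
      exact Submodule.le_topologicalClosure _ (Submodule.subset_span ⟨i, j, a, y, rfl⟩)
  rw [Metric.dense_iff]
  intro t0 δ hδ
  obtain ⟨t1, ht1, ht1'⟩ := Metric.dense_iff.1 hdense t0 (δ / 2) (by positivity)
  obtain ⟨x1, hx1, hx1'⟩ := Metric.dense_iff.1 hdense2 x ε hε
  obtain ⟨N, hN⟩ := claim3 t1 ht1'
  obtain ⟨M, hM, b, hb, w, hw, hbw⟩ := claim2 x1 hx1' N
  have hr : 0 < δ / 2 / (‖w‖ + 1) := by positivity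
  set r : ℝ := δ / 2 / (‖w‖ + 1) with hrd
  refine ⟨t1 + (r : ℂ) • w, ?_, (r : ℂ)⁻¹ • b, ?_⟩
  · rw [Metric.mem_ball, dist_eq_norm] at ht1 ⊢
    have e : t1 + (r : ℂ) • w - t0 = (t1 - t0) + (r : ℂ) • w := by abel
    rw [e]
    refine (norm_add_le _ _).trans_lt ?_
    rw [norm_smul, Complex.norm_real, Real.norm_eq_abs, abs_of_pos hr]
    have : r * ‖w‖ < δ / 2 := by
      rw [hrd, div_mul_eq_mul_div, div_lt_iff₀ (by positivity)]
      nlinarith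
    linarith
  · have hr' : (r : ℂ) ≠ 0 := by exact_mod_cast hr.ne'
    have k := kill N M 0 N (Or.inr le_rfl) b hb t1 hN
    simp only [map_smul, LinearMap.smul_apply, map_add, k, hbw]
    rw [smul_zero, zero_add, smul_smul, mul_inv_cancel₀ hr', one_smul]
    rwa [Metric.mem_ball, dist_eq_norm, norm_sub_rev] at hx1

lemma countable_of_mem_closure_span {V : Type*} [NormedAddCommGroup V] [NormedSpace ℂ V]
    (S : Set V) (v : V) (hv : v ∈ closure (Submodule.span ℂ S : Set V)) :
    ∃ T : Set V, T.Countable ∧ T ⊆ S ∧ v ∈ closure (Submodule.span ℂ T : Set V) := by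
  obtain ⟨u, hu, hlim⟩ := mem_closure_iff_seq_limit.1 hv
  choose T hT hT' using fun n => Submodule.mem_span_finite_of_mem_span (hu n)
  refine ⟨⋃ n, (T n : Set V), Set.countable_iUnion fun n => (T n).countable_toSet,
    Set.iUnion_subset hT, mem_closure_iff_seq_limit.2 ⟨u, fun n => ?_, hlim⟩⟩
  exact Submodule.span_mono (Set.subset_iUnion (fun n => (T n : Set V)) n) (hT' n)

open EquivBimodule in
/-- Countable generation. -/
lemma countable_generation {X B : Type*} [NormedAddCommGroup X] [NormedSpace ℂ X]
    [NormedAddCommGroup B] [NormedSpace ℂ B]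
    (act act' : B →ₗ[ℂ] X →ₗ[ℂ] X) (hc : ∀ x, Continuous fun b => act' b x)
    (ip : X → X → B) (hip : ∀ x y z, ∃ b, act' (ip y x) z = act b x)
    (hfull : Dense (Submodule.span ℂ {b : B | ∃ x y, b = ip y x} : Set B))
    (g : ℕ → B)
    (hg : Dense (Submodule.span ℂ {x : X | ∃ j y, x = act' (g j) y} : Set X)) :
    ∃ R : Set X, R.Countable ∧ R.Nonempty ∧
      Dense (Submodule.span ℂ {x : X | ∃ b, ∃ r ∈ R, x = act b r} : Set X) := by
  choose T hT hTS hTg using fun j => countable_of_mem_closure_span _ (g j) (hfull (g j))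
  choose px hpx using fun (j : ℕ) (b : T j) => hTS j b.2
  have : ∀ j, Countable (T j) := fun j => (hT j).to_subtype
  refine ⟨insert 0 (Set.range fun p : (Σ j, T j) => px p.1 p.2),
    (Set.countable_range _).insert _, Set.insert_nonempty _ _, ?_⟩
  intro x
  refine dense_span_induction hg (Submodule.topologicalClosure _)
    (Submodule.isClosed_topologicalClosure _) ?_ x
  rintro _ ⟨j, z, rfl⟩
  have hcl : IsClosed ((Submodule.comap (act'.flip z) (Submodule.topologicalClosure
    (Submodule.span ℂ {x : X | ∃ b, ∃ r ∈ insert 0 (Set.range fun p : (Σ j, T j) => px p.1 p.2),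
      x = act b r}))) : Set B) := (Submodule.isClosed_topologicalClosure _).preimage (hc z)
  refine closure_minimal (Submodule.span_le.2 ?_) hcl (hTg j)
  intro b hb
  obtain ⟨y, hy⟩ := hpx j ⟨b, hb⟩
  obtain ⟨b', hb'⟩ := hip (px j ⟨b, hb⟩) y z
  refine Submodule.le_topologicalClosure _ (Submodule.subset_span
    ⟨b', px j ⟨b, hb⟩, Set.mem_insert_of_mem _ ⟨⟨j, b, hb⟩, rfl⟩, ?_⟩)
  rw [← hb', ← hy]
  rfl

open EquivBimodule in
lemma orbit_dense {X B : Type*} [NormedAddCommGroup X] [NormedSpace ℂ X]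
    [AddCommGroup B] [Module ℂ B]
    (act : B →ₗ[ℂ] X →ₗ[ℂ] X) (hc : ∀ b, Continuous (act b))
    (hassoc : ∀ b b', ∃ b'', ∀ x, act b (act b' x) = act b'' x)
    (R : Set X) (hR : Dense (Submodule.span ℂ {x : X | ∃ b, ∃ r ∈ R, x = act b r} : Set X))
    (t : X) (ht : ∀ r ∈ R, ∀ n : ℕ, ∃ b, ‖r - act b t‖ < 1 / ((n : ℝ) + 1)) :
    DenseRange fun b => act b t := by
  intro x
  let Z := (LinearMap.range (act.flip t)).topologicalClosure
  have hZ : IsClosed (Z : Set X) := Submodule.isClosed_topologicalClosure _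
  have hx : x ∈ Z := by
    refine dense_span_induction hR Z hZ ?_ x
    rintro _ ⟨b, r, hr, rfl⟩
    have hrZ : r ∈ Z := by
      refine Metric.mem_closure_iff.2 fun ε hε => ?_
      obtain ⟨n, hn⟩ := exists_nat_one_div_lt hε
      obtain ⟨b, hb⟩ := ht r hr n
      exact ⟨act b t, ⟨b, rfl⟩, by rw [dist_eq_norm]; exact hb.trans hn⟩
    have hcl : IsClosed ((Z.comap (act b)) : Set X) := hZ.preimage (hc b)
    refine closure_minimal ?_ hcl hrZ
    rintro _ ⟨b', rfl⟩
    obtain ⟨b'', hb''⟩ := hassoc b b'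
    exact Submodule.le_topologicalClosure _ ⟨b'', (hb'' t).symm⟩
  exact hx

lemma exists_ext {V P Q : Type*} [AddCommGroup V] [Module ℂ V] [NormedAddCommGroup P]
    [NormedSpace ℂ P] [CompleteSpace P] [NormedAddCommGroup Q] [NormedSpace ℂ Q] [CompleteSpace Q]
    (p : V →ₗ[ℂ] P) (q : V →ₗ[ℂ] Q) (hp : DenseRange p) (hq : DenseRange q)
    (hn : ∀ v, ‖p v‖ = ‖q v‖) : ∃ W : P ≃L[ℂ] Q, ∀ v, W (p v) = q v := by
  refine ⟨(LinearEquiv.refl ℂ V).extend p q hp ⟨1, fun v => ?_⟩ hq ⟨1, fun v => ?_⟩, fun v => ?_⟩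
  · simp [hn]
  · simp [hn]
  · simp

open EquivBimodule in
lemma exists_cyclic {A B X : Type*} [NonUnitalCStarAlgebra A]
    [NonUnitalCStarAlgebra B] [PartialOrder B] [StarOrderedRing B]
    [NormedAddCommGroup X] [NormedSpace ℂ X] [CompleteSpace X]
    (M : EquivBimodule B B X) (E : ℕ → ℕ → A → B)
    (hmul : ∀ i j k l a b, E i j a * E k l b = if j = k then E i l (a * b) else 0)
    (hcont : ∀ i j, Continuous (E i j))
    (hdense : Dense (Submodule.span ℂ {b : B | ∃ i j a, b = E i j a} : Set B))
    (h : A) (hl : DenseRange fun a => h * a) (hr : DenseRange fun a => a * h) :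
    ∃ t : X, (DenseRange fun b => M.lsmul b t) ∧ DenseRange fun b => M.rsmul t b := by
  -- left generation
  have h0 : ∀ y, M.lsmul 0 y = 0 := fun y => LinearMap.map_zero₂ M.lL y
  have h0' : ∀ y, M.rsmul y 0 = 0 := fun y => LinearMap.map_zero₂ M.rL y
  obtain ⟨R, hRc, hRn, hR⟩ := countable_generation M.lL M.rL M.continuous_rsmul'
    (fun y x => M.rinn y x) (fun x y z => ⟨M.linn z y, (M.imprimitivity z y x).symm⟩)
    (by
      have hset : {b | ∃ x y, b = M.rinn y x} = {d | ∃ x y, d = M.rinn x y} := by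
        ext b
        exact ⟨fun ⟨a, c, h⟩ => ⟨c, a, h⟩, fun ⟨a, c, h⟩ => ⟨c, a, h⟩⟩
      rw [hset]
      exact M.full_right)
    (fun j => E j j h) (by
      intro x
      refine M.right_total hdense (Submodule.topologicalClosure _)
        (Submodule.isClosed_topologicalClosure _) ?_ x
      rintro _ ⟨i, j, a, rfl⟩ y
      refine hr.induction_on (p := fun a => M.rsmul y (E i j a) ∈
        Submodule.topologicalClosure (Submodule.span ℂ {x : X | ∃ j y, x = M.rL (E j j h) y})) a
        ?_ ?_
      · exact (Submodule.isClosed_topologicalClosure _).preimage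
          ((M.continuous_rsmul' y).comp (hcont i j))
      · intro a
        refine Submodule.le_topologicalClosure _ (Submodule.subset_span
          ⟨j, M.rsmul y (E i j a), ?_⟩)
        rw [rL_apply, ← M.rsmul_mul, hmul, if_pos rfl])
  obtain ⟨R', hRc', hRn', hR'⟩ := countable_generation M.rL M.lL M.continuous_lsmul'
    (fun y x => M.linn x y) (fun x y z => ⟨M.rinn y z, M.imprimitivity x y z⟩)
    M.full_left
    (fun j => E j j h) (by
      intro x
      refine M.left_total hdense (Submodule.topologicalClosure _)
        (Submodule.isClosed_topologicalClosure _) ?_ x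
      rintro _ ⟨i, j, a, rfl⟩ y
      refine hl.induction_on (p := fun a => M.lsmul (E i j a) y ∈
        Submodule.topologicalClosure (Submodule.span ℂ {x : X | ∃ j y, x = M.lL (E j j h) y})) a
        ?_ ?_
      · exact (Submodule.isClosed_topologicalClosure _).preimage
          ((M.continuous_lsmul' y).comp (hcont i j))
      · intro a
        refine Submodule.le_topologicalClosure _ (Submodule.subset_span
          ⟨i, M.lsmul (E i j a) y, ?_⟩)
        rw [lL_apply, ← M.mul_lsmul, hmul, if_pos rfl])
  have dL : ∀ (x : X) (ε : ℝ), 0 < ε → Dense {t : X | ∃ b, ‖x - M.lL b t‖ < ε} := by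
    refine generic_dense M.lL E h (fun a => h * a) hl ?_
      (fun i j y => (M.continuous_lsmul' y).comp (hcont i j)) ?_
    · intro i j k l a y
      rw [lL_apply, lL_apply, ← M.mul_lsmul, hmul]
      split_ifs
      · rfl
      · exact h0 y
    · intro x
      refine M.left_total hdense (Submodule.topologicalClosure _)
        (Submodule.isClosed_topologicalClosure _) ?_ x
      rintro _ ⟨i, j, a, rfl⟩ y
      exact Submodule.le_topologicalClosure _ (Submodule.subset_span ⟨i, j, a, y, rfl⟩)
  have dR : ∀ (x : X) (ε : ℝ), 0 < ε → Dense {t : X | ∃ b, ‖x - M.rL b t‖ < ε} := by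
    refine generic_dense M.rL (fun i j a => E j i a) h (fun a => a * h) hr ?_
      (fun i j y => (M.continuous_rsmul' y).comp (hcont j i)) ?_
    · intro i j k l a y
      rw [rL_apply, rL_apply, ← M.rsmul_mul, hmul]
      by_cases hjk : j = k
      · rw [if_pos hjk, if_pos hjk.symm]; rfl
      · rw [if_neg hjk, if_neg (Ne.symm hjk)]; exact h0' y
    · intro x
      refine M.right_total hdense (Submodule.topologicalClosure _)
        (Submodule.isClosed_topologicalClosure _) ?_ x
      rintro _ ⟨i, j, a, rfl⟩ y
      exact Submodule.le_topologicalClosure _ (Submodule.subset_span ⟨j, i, a, y, rfl⟩)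
  have hopen : ∀ (act : B →ₗ[ℂ] X →ₗ[ℂ] X) (_ : ∀ b, Continuous (act b)) (x : X) (ε : ℝ),
      IsOpen {t : X | ∃ b, ‖x - act b t‖ < ε} := by
    intro act hact x ε
    simp only [Set.ofPred_exists]
    exact isOpen_iUnion fun b =>
      isOpen_lt (continuous_const.sub (hact b)).norm continuous_const
  obtain ⟨r, hrr⟩ := hRc.exists_eq_range hRn
  obtain ⟨r', hrr'⟩ := hRc'.exists_eq_range hRn'
  have d1 : Dense (⋂ p : ℕ × ℕ, {t : X | ∃ b, ‖r p.1 - M.lL b t‖ < 1 / ((p.2 : ℝ) + 1)} ∩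
      {t : X | ∃ b, ‖r' p.1 - M.rL b t‖ < 1 / ((p.2 : ℝ) + 1)}) := by
    refine dense_iInter_of_isOpen (fun p => ?_) (fun p => ?_)
    · exact (hopen M.lL M.continuous_lL _ _).inter (hopen M.rL M.continuous_rL _ _)
    · exact (dL _ _ Nat.one_div_pos_of_nat).inter_of_isOpen_left
        (dR _ _ Nat.one_div_pos_of_nat) (hopen M.lL M.continuous_lL _ _)
  obtain ⟨t, ht⟩ := d1.nonempty
  rw [Set.mem_iInter] at ht
  refine ⟨t, ?_, ?_⟩
  · refine orbit_dense M.lL M.continuous_lL (fun b b' => ⟨b * b', fun x => ?_⟩) R hR t ?_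
    · exact (M.mul_lsmul b b' x).symm
    · rw [hrr]
      rintro _ ⟨k, rfl⟩ n
      exact (ht (k, n)).1
  · refine orbit_dense M.rL M.continuous_rL (fun b b' => ⟨b' * b, fun x => ?_⟩) R' hR' t ?_
    · exact (M.rsmul_mul x b' b).symm
    · rw [hrr']
      rintro _ ⟨k, rfl⟩ n
      exact (ht (k, n)).2

open EquivBimodule in
/-- Polar decomposition: a doubly cyclic vector gives a left-module unitary `B ≃ X`. -/
lemma exists_unitary {B X : Type*}
    [NonUnitalCStarAlgebra B] [PartialOrder B] [StarOrderedRing B]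
    [NormedAddCommGroup X] [NormedSpace ℂ X] [CompleteSpace X]
    (M : EquivBimodule B B X) (t : X) (h1 : DenseRange fun b => M.lsmul b t)
    (h2 : DenseRange fun b => M.rsmul t b) :
    ∃ V : B ≃ₗ[ℂ] X, (∀ a b, V (a * b) = M.lsmul a (V b)) ∧
      ∀ a b, M.linn (V a) (V b) = a * star b := by
  set s := CFC.sqrt (M.linn t t) with hs
  have hss : s * s = M.linn t t := CFC.sqrt_mul_sqrt_self _ (M.linn_nonneg t)
  have hst : star s = s := (CFC.sqrt_nonneg (M.linn t t)).isSelfAdjoint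
  let p : B →ₗ[ℂ] B := LinearMap.mulRight ℂ s
  let q : B →ₗ[ℂ] X := M.lL.flip t
  have hpq : ∀ a b, M.linn (q a) (q b) = p a * star (p b) := by
    intro a b
    simp only [p, q, LinearMap.flip_apply, lL_apply, M.linn_lsmul_left, M.linn_lsmul_right,
      LinearMap.mulRight_apply, star_mul, hst, ← hss, mul_assoc]
  have hn : ∀ v, ‖p v‖ = ‖q v‖ := by
    intro v
    refine (sq_eq_sq₀ (norm_nonneg _) (norm_nonneg _)).1 ?_
    rw [← M.norm_linn, hpq, CStarRing.norm_self_mul_star, sq]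
  have hp : DenseRange p := by
    let Z := (LinearMap.range p).topologicalClosure
    have hZ : IsClosed (Z : Set B) := Submodule.isClosed_topologicalClosure _
    have s1 : ∀ x, M.linn x t ∈ Z := fun x =>
      h1.induction_on (p := fun x => M.linn x t ∈ Z) x (hZ.preimage (M.continuous_linn t))
        (fun b => Submodule.le_topologicalClosure _ ⟨b * s, by
          simp [p, mul_assoc, hss, M.linn_lsmul_left]⟩)
    have s2 : ∀ x y, M.linn x y ∈ Z := fun x y =>
      h2.induction_on (p := fun y => M.linn x y ∈ Z) y (hZ.preimage (M.continuous_linn' x))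
        (fun b => by
          have := M.linn_rsmul x t (star b)
          rw [star_star] at this
          rw [← this]
          exact s1 _)
    intro b
    exact dense_span_induction M.full_left Z hZ (by rintro _ ⟨x, y, rfl⟩; exact s2 x y) b
  obtain ⟨W, hW⟩ := exists_ext p q hp h1 hn
  refine ⟨W.toLinearEquiv, fun a b => ?_, fun a b => ?_⟩
  · change W (a * b) = M.lsmul a (W b)
    refine hp.induction_on (p := fun b => W (a * b) = M.lsmul a (W b)) b
      (isClosed_eq (W.continuous.comp (continuous_const.mul continuous_id))
        ((M.continuous_lsmul a).comp W.continuous)) (fun b => ?_)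
    have : a * p b = p (a * b) := by simp [p, mul_assoc]
    rw [this, hW, hW]
    exact M.mul_lsmul a b t
  · change M.linn (W a) (W b) = a * star b
    refine hp.induction_on (p := fun b => M.linn (W a) (W b) = a * star b) b
      (isClosed_eq ((M.continuous_linn' _).comp W.continuous)
        (continuous_const.mul continuous_star)) (fun b => ?_)
    refine hp.induction_on (p := fun a => M.linn (W a) (W (p b)) = a * star (p b)) a
      (isClosed_eq ((M.continuous_linn _).comp W.continuous)
        (continuous_id.mul continuous_const)) (fun a => ?_)
    rw [hW, hW, hpq]

section MultLemmas

variable {C : Type*} [NonUnitalCStarAlgebra C]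

lemma eq_of_mul_left_all {v w : C} (h : ∀ z, z * v = z * w) : v = w := by
  have : star (v - w) * (v - w) = 0 := by rw [mul_sub, h, sub_self]
  exact sub_eq_zero.1 (CStarRing.star_mul_self_eq_zero_iff _ |>.1 this)

lemma eq_of_mul_right_all {v w : C} (h : ∀ z, v * z = w * z) : v = w := by
  have : (v - w) * star (v - w) = 0 := by rw [sub_mul, h, sub_self]
  exact sub_eq_zero.1 (CStarRing.mul_star_self_eq_zero_iff _ |>.1 this)

lemma mult_fst_mul (u : 𝓜(ℂ, C)) (a b : C) : u.fst (a * b) = u.fst a * b := by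
  refine eq_of_mul_left_all fun z => ?_
  rw [← u.central, ← mul_assoc, ← mul_assoc, u.central]

lemma mult_snd_mul (u : 𝓜(ℂ, C)) (a b : C) : u.snd (a * b) = a * u.snd b := by
  refine eq_of_mul_right_all fun z => ?_
  rw [u.central, mul_assoc, mul_assoc, u.central]

lemma mult_star_snd (u : 𝓜(ℂ, C)) (x : C) : (star u).snd x = star (u.fst (star x)) := rfl
lemma mult_star_fst (u : 𝓜(ℂ, C)) (x : C) : (star u).fst x = star (u.snd (star x)) := rfl

lemma exists_mult (φ : C ≃ₗ[ℂ] C) (h1 : ∀ x y, φ (x * y) = x * φ y)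
    (h2 : ∀ x y, φ x * star (φ y) = x * star y) :
    ∃ u : 𝓜(ℂ, C), u ∈ unitary 𝓜(ℂ, C) ∧ (∀ x, u.snd x = φ x) ∧
      ∀ x, u.fst x = star (φ.symm (star x)) := by
  have hn : ∀ x, ‖φ x‖ = ‖x‖ := by
    intro x
    refine (sq_eq_sq₀ (norm_nonneg _) (norm_nonneg _)).1 ?_
    rw [sq, sq, ← CStarRing.norm_self_mul_star, h2, CStarRing.norm_self_mul_star]
  have hn' : ∀ x, ‖φ.symm x‖ = ‖x‖ := fun x => by
    rw [← hn, LinearEquiv.apply_symm_apply]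
  let R : C →L[ℂ] C := (φ : C →ₗ[ℂ] C).mkContinuous 1 (fun x => by simp [hn])
  let Lf : C →ₗ[ℂ] C :=
    { toFun := fun x => star (φ.symm (star x))
      map_add' := fun x y => by simp
      map_smul' := fun z x => by simp }
  let Lc : C →L[ℂ] C := Lf.mkContinuous 1 (fun x => by simp [Lf, hn'])
  have hR : ∀ x, R x = φ x := fun x => rfl
  have hL : ∀ x, Lc x = star (φ.symm (star x)) := fun x => rfl
  let u : 𝓜(ℂ, C) :=
    { fst := Lc
      snd := R
      central := fun x y => by
        have := h2 x (φ.symm (star y))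
        rw [LinearEquiv.apply_symm_apply, star_star] at this
        rw [hR, hL, this] }
  have hu1 : ∀ x, u.snd x = φ x := hR
  have hu2 : ∀ x, u.fst x = star (φ.symm (star x)) := hL
  refine ⟨u, ?_, hu1, hu2⟩
  rw [Unitary.mem_iff]
  constructor
  · refine DoubleCentralizer.ext ℂ C _ _ (Prod.ext ?_ ?_)
    · ext x
      change (star u).fst (u.fst x) = x
      rw [mult_star_fst, hu2, hu1]; simp
    · ext x
      change u.snd ((star u).snd x) = x
      rw [mult_star_snd, hu2, hu1]; simp
  · refine DoubleCentralizer.ext ℂ C _ _ (Prod.ext ?_ ?_)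
    · ext x
      change u.fst ((star u).fst x) = x
      rw [mult_star_fst, hu2, hu1]; simp
    · ext x
      change (star u).snd (u.snd x) = x
      rw [mult_star_snd, hu2, hu1]; simp

lemma unitary_snd (u : 𝓜(ℂ, C)) (hu : u ∈ unitary 𝓜(ℂ, C)) :
    (∀ x, u.snd ((star u).snd x) = x) ∧ (∀ x, (star u).snd (u.snd x) = x) ∧
    (∀ x, u.fst ((star u).fst x) = x) ∧ (∀ x, (star u).fst (u.fst x) = x) := by
  rw [Unitary.mem_iff] at hu
  refine ⟨fun x => ?_, fun x => ?_, fun x => ?_, fun x => ?_⟩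
  · have := congrArg (fun v : 𝓜(ℂ, C) => v.snd x) hu.1; exact this
  · have := congrArg (fun v : 𝓜(ℂ, C) => v.snd x) hu.2; exact this
  · have := congrArg (fun v : 𝓜(ℂ, C) => v.fst x) hu.2; exact this
  · have := congrArg (fun v : 𝓜(ℂ, C) => v.fst x) hu.1; exact this

variable [PartialOrder C] [StarOrderedRing C]

lemma iso_to_mult (α β : C ≃⋆ₐ[ℂ] C) (Ea Eb : EquivBimodule C C C)
    (ha : IsAlphaData ⇑α ⇑α.symm Ea) (hb : IsAlphaData ⇑β ⇑β.symm Eb) (Φ : Ea.Iso Eb) :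
    ∃ u : 𝓜(ℂ, C), u ∈ unitary 𝓜(ℂ, C) ∧ (∀ x, u.snd x = Φ.toEquiv x) ∧
      (∀ x, u.fst x = star (Φ.toEquiv.symm (star x))) ∧ ∀ c, α (β.symm c) = mAd u c := by
  obtain ⟨a1, a2, a3, a4⟩ := ha
  obtain ⟨b1, b2, b3, b4⟩ := hb
  have h1 : ∀ x y, Φ.toEquiv (x * y) = x * Φ.toEquiv y := fun x y => by
    have := Φ.map_lsmul x y; simpa only [a1, b1] using this
  have h2 : ∀ x y, Φ.toEquiv x * star (Φ.toEquiv y) = x * star y := fun x y => by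
    have := Φ.map_linn x y; simpa only [a3, b3] using this
  have h3 : ∀ x c, Φ.toEquiv (x * α c) = Φ.toEquiv x * β c := fun x c => by
    have := Φ.map_rsmul x c; simpa only [a2, b2] using this
  obtain ⟨u, hu, hus, huf⟩ := exists_mult Φ.toEquiv h1 h2
  refine ⟨u, hu, hus, huf, fun c => ?_⟩
  have h1' : ∀ x y, Φ.toEquiv.symm (x * y) = x * Φ.toEquiv.symm y := fun x y => by
    rw [LinearEquiv.symm_apply_eq, h1, LinearEquiv.apply_symm_apply]
  refine eq_of_mul_left_all fun z => ?_
  have e1 : z * α (β.symm c) = Φ.toEquiv z * Φ.toEquiv.symm c := by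
    rw [← h1', LinearEquiv.eq_symm_apply, h3]; simp
  rw [e1]
  unfold mAd
  rw [← u.central, hus, mult_star_snd, huf]; simp

lemma mult_to_iso (α β : C ≃⋆ₐ[ℂ] C) (Ea Eb : EquivBimodule C C C)
    (ha : IsAlphaData ⇑α ⇑α.symm Ea) (hb : IsAlphaData ⇑β ⇑β.symm Eb) (u : 𝓜(ℂ, C))
    (hu : u ∈ unitary 𝓜(ℂ, C)) (h : ∀ c, α (β.symm c) = mAd u c) :
    ∃ Φ : Ea.Iso Eb, (∀ x, Φ.toEquiv x = u.snd x) ∧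
      ∀ x, Φ.toEquiv.symm x = (star u).snd x := by
  obtain ⟨a1, a2, a3, a4⟩ := ha
  obtain ⟨b1, b2, b3, b4⟩ := hb
  obtain ⟨k1, k2, k3, k4⟩ := unitary_snd u hu
  let φ : C ≃ₗ[ℂ] C :=
    { toFun := fun x => u.snd x
      map_add' := fun x y => map_add _ _ _
      map_smul' := fun z x => map_smul _ _ _
      invFun := fun x => (star u).snd x
      left_inv := k2
      right_inv := k1 }
  have hφ : ∀ x, φ x = u.snd x := fun x => rfl
  have h' : ∀ c, α c = mAd u (β c) := fun c => by rw [← h]; simp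
  have key : ∀ x c, φ (x * α c) = φ x * β c := by
    intro x c
    rw [hφ, hφ, mult_snd_mul, u.central, h', mAd]
    -- u.snd (u.fst ((star u).snd b)) = u.fst b
    congr 1
    refine eq_of_mul_right_all fun z => ?_
    rw [u.central, ← mult_fst_mul, ← mult_fst_mul, (star u).central]
    congr 2
    exact k4 z
  have hl : ∀ x y, φ x * star (φ y) = x * star y := by
    intro x y
    rw [hφ, u.central]
    congr 1
    have := k3 (star y)
    rw [mult_star_fst, star_star] at this
    exact this
  have hadj : ∀ x, star (u.snd x) = (star u).fst (star x) := fun x => by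
    rw [mult_star_fst, star_star]
  refine ⟨⟨φ, ?_, ?_, ?_, ?_⟩, fun x => rfl, fun x => rfl⟩
  · intro c y; simp only [a1, b1]; exact mult_snd_mul u c y
  · intro y d; simp only [a2, b2]; exact key y d
  · intro x y; simp only [a3, b3]; exact hl x y
  · intro x y
    simp only [a4, b4]
    -- β.symm (star (φ x) * φ y) = α.symm (star x * y)
    apply EquivLike.injective α
    rw [h, hφ, hφ, mAd, mult_snd_mul, k2, hadj, mult_fst_mul, k3]; simp

end MultLemmas

namespace EquivBimodule

lemma dense_span_mul {C : Type*} [NonUnitalCStarAlgebra C] [PartialOrder C] [StarOrderedRing C]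
    {S : Set C} (hS : ∀ x y : C, x * y ∈ S) : Dense (Submodule.span ℂ S : Set C) := by
  intro a
  rw [Metric.mem_closure_iff]
  intro ε hε
  obtain ⟨c, -, -, hc⟩ := dense_approx a ε hε
  exact ⟨c * a, Submodule.subset_span (hS _ _), by rwa [dist_eq_norm]⟩

def Iso.symm {C D Y W : Type*}
    [NonUnitalCStarAlgebra C] [PartialOrder C] [StarOrderedRing C]
    [NonUnitalCStarAlgebra D] [PartialOrder D] [StarOrderedRing D]
    [NormedAddCommGroup Y] [NormedSpace ℂ Y] [CompleteSpace Y]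
    [NormedAddCommGroup W] [NormedSpace ℂ W] [CompleteSpace W]
    {E : EquivBimodule C D Y} {F : EquivBimodule C D W} (Φ : E.Iso F) : F.Iso E where
  toEquiv := Φ.toEquiv.symm
  map_lsmul c y := by rw [LinearEquiv.symm_apply_eq, Φ.map_lsmul]; simp
  map_rsmul c y := by rw [LinearEquiv.symm_apply_eq, Φ.map_rsmul]; simp
  map_linn x y := by rw [← Φ.map_linn]; simp
  map_rinn x y := by rw [← Φ.map_rinn]; simp

def Iso.trans {C D Y W Z : Type*}
    [NonUnitalCStarAlgebra C] [PartialOrder C] [StarOrderedRing C]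
    [NonUnitalCStarAlgebra D] [PartialOrder D] [StarOrderedRing D]
    [NormedAddCommGroup Y] [NormedSpace ℂ Y] [CompleteSpace Y]
    [NormedAddCommGroup W] [NormedSpace ℂ W] [CompleteSpace W]
    [NormedAddCommGroup Z] [NormedSpace ℂ Z] [CompleteSpace Z]
    {E : EquivBimodule C D Y} {F : EquivBimodule C D W} {G : EquivBimodule C D Z}
    (Φ : E.Iso F) (Ψ : F.Iso G) : E.Iso G where
  toEquiv := Φ.toEquiv.trans Ψ.toEquiv
  map_lsmul c y := by simp [Φ.map_lsmul, Ψ.map_lsmul]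
  map_rsmul c y := by simp [Φ.map_rsmul, Ψ.map_rsmul]
  map_linn x y := by simp [Φ.map_linn, Ψ.map_linn]
  map_rinn x y := by simp [Φ.map_rinn, Ψ.map_rinn]

def alphaBimodule {C : Type*} [NonUnitalCStarAlgebra C] [PartialOrder C] [StarOrderedRing C]
    (α : C ≃⋆ₐ[ℂ] C) : EquivBimodule C C C where
  lsmul c x := c * x
  rsmul x c := x * α c
  linn x y := x * star y
  rinn x y := α.symm (star x * y)
  lsmul_add := by intros; rw [mul_add]
  add_lsmul := by intros; rw [add_mul]
  mul_lsmul := by intros; rw [mul_assoc]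
  smul_lsmul := by intros; rw [smul_mul_assoc]
  lsmul_smul := by intros; rw [mul_smul_comm]
  add_rsmul := by intros; rw [add_mul]
  rsmul_add := by intros; rw [map_add, mul_add]
  rsmul_mul := by intros; rw [map_mul, mul_assoc]
  rsmul_smul := by intros; rw [smul_mul_assoc]
  smul_rsmul := by intros; rw [map_smul, mul_smul_comm]
  lsmul_rsmul := by intros; rw [mul_assoc]
  linn_add_left := by intros; rw [add_mul]
  linn_smul_left := by intros; rw [smul_mul_assoc]
  linn_star := by intros; rw [star_mul, star_star]
  linn_lsmul_left := by intros; rw [mul_assoc]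
  linn_nonneg x := mul_star_self_nonneg x
  linn_definite x h := (CStarRing.mul_star_self_eq_zero_iff _).1 h
  rinn_add_right := by intros; rw [mul_add, map_add]
  rinn_smul_right := by intros; rw [mul_smul_comm, map_smul]
  rinn_star := by intros; rw [← map_star, star_mul, star_star]
  rinn_rsmul_right x y d := by rw [← mul_assoc, map_mul]; simp
  rinn_nonneg x := by rw [map_mul, map_star]; exact star_mul_self_nonneg _
  rinn_definite x h := by
    rw [EmbeddingLike.map_eq_zero_iff] at h
    exact (CStarRing.star_mul_self_eq_zero_iff _).1 h
  imprimitivity x y z := by simp [mul_assoc]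
  norm_linn x := by rw [CStarRing.norm_self_mul_star, sq]
  norm_rinn x := by
    rw [StarAlgEquiv.norm_map, CStarRing.norm_star_mul_self, sq]
  full_left := dense_span_mul fun x y => ⟨x, star y, by simp⟩
  full_right := dense_span_mul fun x y => ⟨star (α x), α y, by
    rw [star_star, ← map_mul]; simp⟩

lemma alphaBimodule_data {C : Type*} [NonUnitalCStarAlgebra C] [PartialOrder C]
    [StarOrderedRing C] (α : C ≃⋆ₐ[ℂ] C) : IsAlphaData ⇑α ⇑α.symm (alphaBimodule α) :=
  ⟨rfl, rfl, rfl, rfl⟩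

lemma exists_alpha {C Y : Type*} [NonUnitalCStarAlgebra C] [PartialOrder C] [StarOrderedRing C]
    [NormedAddCommGroup Y] [NormedSpace ℂ Y] [CompleteSpace Y]
    (F : EquivBimodule C C Y) (W : C ≃ₗ[ℂ] Y) (h1 : ∀ c d, W (c * d) = F.lsmul c (W d))
    (h2 : ∀ x y, F.linn (W x) (W y) = x * star y) :
    ∃ α : C ≃⋆ₐ[ℂ] C, ∃ Φ : (alphaBimodule α).Iso F, ∀ c, Φ.toEquiv c = W c := by
  have hn : ∀ x, ‖W x‖ = ‖x‖ := by
    intro x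
    refine (sq_eq_sq₀ (norm_nonneg _) (norm_nonneg _)).1 ?_
    rw [← F.norm_linn, h2, CStarRing.norm_self_mul_star, sq]
  have hWc : Continuous W :=
    ((W : C →ₗ[ℂ] Y).mkContinuous 1 (fun x => by simp [hn])).continuous
  have huniq : ∀ e e' : C, (∀ x, W (x * e) = W (x * e')) → e = e' := fun e e' h =>
    eq_of_mul_left_all fun z => W.injective (h z)
  -- the graph
  let G : Submodule ℂ (C × C) :=
    { carrier := {p | ∀ x, F.rsmul (W x) p.1 = W (x * p.2)}
      add_mem' := fun {p q} hp hq x => by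
        rw [Prod.fst_add, Prod.snd_add, F.rsmul_add, hp, hq, mul_add, map_add]
      zero_mem' := fun x => by
        have : F.rsmul (W x) 0 = 0 := LinearMap.map_zero₂ F.rL (W x)
        simp [this]
      smul_mem' := fun z p hp x => by
        rw [Prod.smul_fst, Prod.smul_snd, F.smul_rsmul, hp, mul_smul_comm, map_smul] }
  have hGmem : ∀ p : C × C, p ∈ G ↔ ∀ x, F.rsmul (W x) p.1 = W (x * p.2) := fun p => Iff.rfl
  have hGc : IsClosed (G : Set (C × C)) := by
    have : (G : Set (C × C)) = ⋂ x, {p : C × C | F.rsmul (W x) p.1 = W (x * p.2)} := by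
      ext p
      simp [hGmem]
    rw [this]
    exact isClosed_iInter fun x => isClosed_eq ((F.continuous_rsmul' _).comp continuous_fst)
      (hWc.comp (continuous_const.mul continuous_snd))
  have hbound : ∀ p ∈ G, ‖p.2‖ ≤ ‖p.1‖ := by
    intro p hp
    have e1 := (hGmem p).1 hp (star p.2)
    have e2 := F.norm_rsmul_le (W (star p.2)) p.1
    rw [e1, hn, hn, CStarRing.norm_star_mul_self, norm_star] at e2
    by_cases h0 : ‖p.2‖ = 0
    · rw [h0]; exact norm_nonneg _
    · exact le_of_mul_le_mul_right e2 (lt_of_le_of_ne (norm_nonneg _) (Ne.symm h0))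
  let π : G →ₗ[ℂ] C := (LinearMap.fst ℂ C C).comp G.subtype
  have hπ : AntilipschitzWith 1 π := by
    refine AddMonoidHomClass.antilipschitz_of_bound π fun p => ?_
    rw [NNReal.coe_one, one_mul]
    have := hbound p.1 p.2
    change ‖p.1‖ ≤ ‖p.1.1‖
    exact max_le le_rfl this
  have : CompleteSpace G := hGc.completeSpace_coe
  have hπr : IsClosed (Set.range π) :=
    hπ.isClosed_range (uniformContinuous_fst.comp uniformContinuous_subtype_val)
  have hsurj : ∀ d : C, ∃ e, ∀ x, F.rsmul (W x) d = W (x * e) := by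
    intro d
    have hmem : d ∈ LinearMap.range π := by
      refine dense_span_induction F.full_right (LinearMap.range π)
        (by rw [LinearMap.coe_range]; exact hπr) ?_ d
      rintro _ ⟨y, z, rfl⟩
      refine ⟨⟨(F.rinn y z, star (W.symm y) * W.symm z), ?_⟩, rfl⟩
      rw [hGmem]
      intro x
      change F.rsmul (W x) (F.rinn y z) = W (x * (star (W.symm y) * W.symm z))
      have := h2 x (W.symm y)
      rw [LinearEquiv.apply_symm_apply] at this
      rw [← F.imprimitivity, this, ← mul_assoc, h1 (x * star (W.symm y)),
        LinearEquiv.apply_symm_apply]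
    obtain ⟨⟨p, hp⟩, rfl⟩ := hmem
    exact ⟨p.2, hp⟩
  choose f hf using hsurj
  have hfu : ∀ d e, (∀ x, F.rsmul (W x) d = W (x * e)) → f d = e := fun d e h =>
    huniq _ _ fun x => by rw [← hf, h]
  have hfinn : ∀ y z, f (F.rinn y z) = star (W.symm y) * W.symm z := by
    intro y z
    refine hfu _ _ fun x => ?_
    have := h2 x (W.symm y)
    rw [LinearEquiv.apply_symm_apply] at this
    rw [← F.imprimitivity, this, ← mul_assoc, h1 (x * star (W.symm y)),
      LinearEquiv.apply_symm_apply]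
  let φ : C →⋆ₙₐ[ℂ] C :=
    { toFun := f
      map_add' := fun a b => hfu _ _ fun x => by
        rw [F.rsmul_add, hf, hf, mul_add, map_add]
      map_zero' := hfu _ _ fun x => by
        have : F.rsmul (W x) 0 = 0 := LinearMap.map_zero₂ F.rL (W x)
        simp [this]
      map_mul' := fun a b => hfu _ _ fun x => by
        rw [F.rsmul_mul, hf, hf, mul_assoc]
      map_smul' := fun z a => hfu _ _ fun x => by
        rw [F.smul_rsmul, hf, MonoidHom.id_apply, mul_smul_comm, map_smul]
      map_star' := fun a => by
        refine eq_of_mul_left_all fun z => ?_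
        have e1 : ∀ y, z * f (star a) * star y = z * star (f a) * star y := by
          intro y
          have := F.linn_rsmul (W z) (W y) (star a)
          rw [hf, star_star, hf, h2, h2, star_mul] at this
          rw [this, mul_assoc]
        exact eq_of_mul_right_all fun y => by
          have := e1 (star y); rwa [star_star] at this }
  have hφ : ∀ d, φ d = f d := fun d => rfl
  have hinj : Function.Injective φ := by
    rw [injective_iff_map_eq_zero]
    intro d hd
    have e1 : ∀ y, F.rsmul y d = 0 := fun y => by
      have := hf d (W.symm y)
      rw [← hφ, hd] at this; simpa using this
    have e2 : ∀ c : C, c * d = 0 := fun c => by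
      refine eq_of_dense_span F.full_right (LinearMap.mulRight ℂ d) 0
        (continuous_id.mul continuous_const) continuous_const ?_ c
      rintro _ ⟨x, y, rfl⟩
      rw [LinearMap.mulRight_apply, ← F.rinn_rsmul_right, e1, LinearMap.zero_apply]
      exact map_zero (F.rI x)
    exact eq_of_mul_left_all fun z => by rw [e2, mul_zero]
  have hiso : Isometry φ := NonUnitalStarAlgHom.isometry φ hinj
  have hsur : Function.Surjective φ := by
    intro e
    have : e ∈ LinearMap.range (φ : C →ₗ[ℂ] C) := by
      refine dense_span_induction (S := {e : C | ∃ x y : C, e = x * y})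
        (dense_span_mul fun x y => ⟨x, y, rfl⟩) _ ?_ ?_ e
      · rw [LinearMap.coe_range]
        exact hiso.isClosedEmbedding.isClosed_range
      · rintro _ ⟨x, y, rfl⟩
        refine ⟨F.rinn (W (star x)) (W y), ?_⟩
        change f _ = _
        rw [hfinn]; simp
    exact this
  let α : C ≃⋆ₐ[ℂ] C := StarAlgEquiv.ofBijective φ ⟨hinj, hsur⟩
  have hα : ∀ d, α d = f d := fun d => rfl
  refine ⟨α, ⟨W, h1, fun y d => ?_, h2, fun x y => ?_⟩, fun c => rfl⟩
  · change W (y * α d) = _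
    rw [hα, hf]
  · change _ = α.symm (star x * y)
    rw [← EmbeddingLike.apply_eq_iff_eq α, StarAlgEquiv.apply_symm_apply, hα, hfinn]; simp
end EquivBimodule

section Extend

open EquivBimodule

lemma dense_incl_star {A C : Type*} [NonUnitalCStarAlgebra A] [NonUnitalCStarAlgebra C]
    (ι : A →⋆ₙₐ[ℂ] C) (hd : DenseIncl ⇑ι) :
    Dense (Submodule.span ℂ {x : C | ∃ (c : C) (a : A), x = c * ι a} : Set C) := by
  let Z := (Submodule.span ℂ {x : C | ∃ (c : C) (a : A), x = c * ι a}).topologicalClosure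
  have hZ : IsClosed (Z : Set C) := Submodule.isClosed_topologicalClosure _
  let Z' : Submodule ℂ C :=
    { carrier := {c | star c ∈ Z}
      add_mem' := fun {a b} ha hb => by
        change star (a + b) ∈ Z
        rw [star_add]; exact Z.add_mem ha hb
      zero_mem' := by
        change star 0 ∈ Z
        rw [star_zero]; exact Z.zero_mem
      smul_mem' := fun z a ha => by
        change star (z • a) ∈ Z
        rw [star_smul]; exact Z.smul_mem _ ha }
  intro c
  have : star c ∈ Z' := dense_span_induction hd Z' (hZ.preimage continuous_star) (by
    rintro _ ⟨a, c, rfl⟩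
    change star (ι a * c) ∈ Z
    exact Submodule.le_topologicalClosure _ (Submodule.subset_span
      ⟨star c, star a, by rw [star_mul, map_star]⟩)) _
  change star (star c) ∈ Z at this
  rw [star_star] at this
  exact this

lemma rangeSub_mem {A C : Type*} [NonUnitalCStarAlgebra A] [NonUnitalCStarAlgebra C]
    (ι : A →⋆ₙₐ[ℂ] C) (c : C) : c ∈ rangeSub ⇑ι ↔ ∃ a, ι a = c := by
  have : rangeSub ⇑ι = LinearMap.range (ι : A →ₗ[ℂ] C) := by
    unfold rangeSub
    have h : Set.range ⇑ι = (LinearMap.range (ι : A →ₗ[ℂ] C) : Set C) := by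
      rw [LinearMap.coe_range]; rfl
    rw [h, Submodule.span_eq]
  rw [this]
  rfl

theorem extend_pair {As Cs Yt : Type*}
    [NonUnitalCStarAlgebra As] [PartialOrder As] [StarOrderedRing As]
    [NonUnitalCStarAlgebra Cs] [PartialOrder Cs] [StarOrderedRing Cs]
    [NormedAddCommGroup Yt] [NormedSpace ℂ Yt] [CompleteSpace Yt]
    (ιs : As →⋆ₙₐ[ℂ] Cs) (hιs : Function.Injective ιs) (hds : DenseIncl ⇑ιs)
    (F : EquivBimodule Cs Cs Yt) (X : Submodule ℂ Yt) [CompleteSpace X]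
    (MX : EquivBimodule As As X) (hE : IsEquiPair ⇑ιs F X)
    (hM : IsRestriction ⇑ιs ⇑ιs F X MX) (V : As ≃ₗ[ℂ] X)
    (v1 : ∀ a b, V (a * b) = MX.lsmul a (V b))
    (v2 : ∀ a b, MX.linn (V a) (V b) = a * star b) :
    ∃ α : Cs ≃⋆ₐ[ℂ] Cs, ⇑α '' Set.range ⇑ιs = Set.range ⇑ιs ∧
      PairEquiv (alphaBimodule α) (rangeSub ⇑ιs) F X ∧
      ∃ αA : As ≃⋆ₐ[ℂ] As, (∀ a : As, α (ιs a) = ιs (αA a)) ∧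
        ∃ Φ : (alphaBimodule αA).Iso MX, ∀ a, Φ.toEquiv a = V a := by
  have hds' := dense_incl_star ιs hds
  let p : TensorProduct ℂ Cs As →ₗ[ℂ] Cs :=
    TensorProduct.lift ((LinearMap.mul ℂ Cs).compl₂ (ιs : As →ₗ[ℂ] Cs))
  let q : TensorProduct ℂ Cs As →ₗ[ℂ] Yt :=
    TensorProduct.lift (F.lL.compl₂ (X.subtype ∘ₗ (V : As →ₗ[ℂ] X)))
  have hp : ∀ c a, p (c ⊗ₜ a) = c * ιs a := fun c a => rfl
  have hq : ∀ c a, q (c ⊗ₜ a) = F.lsmul c (V a) := fun c a => rfl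
  have hpq : ∀ s t, F.linn (q s) (q t) = p s * star (p t) := by
    intro s t
    induction s using TensorProduct.induction_on with
    | zero =>
      rw [map_zero, map_zero, zero_mul]
      exact map_zero (F.lI _)
    | add x y hx hy => rw [map_add, map_add, F.linn_add_left, hx, hy, add_mul]
    | tmul c a =>
      induction t using TensorProduct.induction_on with
      | zero =>
        rw [map_zero, map_zero, star_zero, mul_zero, ← F.linn_star]
        have : F.linn 0 (q (c ⊗ₜ a)) = 0 := map_zero (F.lI _)
        rw [this, star_zero]
      | add x y hx hy =>
        rw [map_add, map_add, F.linn_add_right, hx, hy, star_add, mul_add]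
      | tmul c' a' =>
        rw [hq, hq, hp, hp, F.linn_lsmul_left, F.linn_lsmul_right, ← hM.linn_coe, v2, map_mul,
          map_star, star_mul]
        simp only [mul_assoc]
  have hn : ∀ v, ‖p v‖ = ‖q v‖ := by
    intro v
    refine (sq_eq_sq₀ (norm_nonneg _) (norm_nonneg _)).1 ?_
    rw [← F.norm_linn, hpq, CStarRing.norm_self_mul_star, sq]
  have dp : DenseRange p := by
    intro c
    exact dense_span_induction hds' (LinearMap.range p).topologicalClosure
      (Submodule.isClosed_topologicalClosure _) (by
        rintro _ ⟨c, a, rfl⟩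
        exact Submodule.le_topologicalClosure _ ⟨c ⊗ₜ a, rfl⟩) c
  have dq : DenseRange q := by
    let Z := (LinearMap.range q).topologicalClosure
    have hZ : IsClosed (Z : Set Yt) := Submodule.isClosed_topologicalClosure _
    have s1 : ∀ y b, F.rsmul y (ιs b) ∈ Z := by
      intro y b
      have hmem : ιs b ∈ closure (Submodule.span ℂ
          {d : Cs | ∃ x ∈ X, ∃ y ∈ X, d = F.rinn x y} : Set Cs) := by
        rw [hE.span_XX_right]; exact ⟨b, rfl⟩
      have hle : (Submodule.span ℂ {d : Cs | ∃ x ∈ X, ∃ y ∈ X, d = F.rinn x y}) ≤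
          Z.comap (F.rL.flip y) := by
        rw [Submodule.span_le]
        rintro _ ⟨x, hx, x', hx', rfl⟩
        change F.rsmul y (F.rinn x x') ∈ Z
        rw [← F.imprimitivity]
        exact Submodule.le_topologicalClosure _ ⟨F.linn y x ⊗ₜ V.symm ⟨x', hx'⟩, by
          rw [hq]; simp⟩
      exact closure_minimal hle (hZ.preimage (F.continuous_rsmul' y)) hmem
    intro y
    refine F.right_total hds' Z hZ ?_ y
    rintro _ ⟨c, b, rfl⟩ y
    rw [F.rsmul_mul]
    exact s1 _ _
  obtain ⟨W, hW⟩ := exists_ext p q dp dq hn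
  have w1 : ∀ c d, W (c * d) = F.lsmul c (W d) := by
    intro c d
    refine dp.induction_on (p := fun d => W (c * d) = F.lsmul c (W d)) d
      (isClosed_eq (W.continuous.comp (continuous_const.mul continuous_id))
        ((F.continuous_lsmul c).comp W.continuous)) (fun t => ?_)
    induction t using TensorProduct.induction_on with
    | zero => simpa using (map_zero (F.lL c)).symm
    | add x y hx hy => rw [map_add, mul_add, map_add, hx, hy, map_add, F.lsmul_add]
    | tmul c' a =>
      have : c * p (c' ⊗ₜ a) = p ((c * c') ⊗ₜ a) := by rw [hp, hp, mul_assoc]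
      rw [this, hW, hW, hq, hq, F.mul_lsmul]
  have w2 : ∀ a b, F.linn (W a) (W b) = a * star b := by
    intro a b
    refine dp.induction_on (p := fun b => F.linn (W a) (W b) = a * star b) b
      (isClosed_eq ((F.continuous_linn' _).comp W.continuous)
        (continuous_const.mul continuous_star)) (fun b => ?_)
    refine dp.induction_on (p := fun a => F.linn (W a) (W (p b)) = a * star (p b)) a
      (isClosed_eq ((F.continuous_linn _).comp W.continuous)
        (continuous_id.mul continuous_const)) (fun a => ?_)
    rw [hW, hW, hpq]
  have hVn : ∀ a, ‖V a‖ = ‖a‖ := by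
    intro x
    refine (sq_eq_sq₀ (norm_nonneg _) (norm_nonneg _)).1 ?_
    rw [← MX.norm_linn, v2, CStarRing.norm_self_mul_star, sq]
  have hVc : Continuous V :=
    ((V : As →ₗ[ℂ] X).mkContinuous 1 (fun x => by simp [hVn])).continuous
  have hιc : Continuous ιs := (NonUnitalStarAlgHom.isometry ιs hιs).continuous
  have w3 : ∀ a, W (ιs a) = V a := by
    intro a
    refine eq_of_dense_span (V := As) (S := {e : As | ∃ x y : As, e = x * y})
      (dense_span_mul fun x y => ⟨x, y, rfl⟩)
      ((W : Cs →ₗ[ℂ] Yt) ∘ₗ (ιs : As →ₗ[ℂ] Cs)) (X.subtype ∘ₗ (V : As →ₗ[ℂ] X))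
      (W.continuous.comp hιc) (continuous_subtype_val.comp hVc) ?_ a
    rintro _ ⟨x, y, rfl⟩
    change W (ιs (x * y)) = V (x * y)
    rw [map_mul, ← hp, hW, hq, v1, hM.lsmul_coe]
  obtain ⟨αA, ΦA, hΦA⟩ := exists_alpha MX V v1 v2
  obtain ⟨α, Φ, hΦ⟩ := exists_alpha F W.toLinearEquiv w1 w2
  have hΦ' : ∀ c, Φ.toEquiv c = W c := hΦ
  have hrs : ∀ c d, W (c * α d) = F.rsmul (W c) d := fun c d => by
    rw [← hΦ', ← hΦ']; exact Φ.map_rsmul c d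
  have hrsA : ∀ a b, V (a * αA b) = MX.rsmul (V a) b := fun c d => by
    rw [← hΦA, ← hΦA]; exact ΦA.map_rsmul c d
  have hα : ∀ a, α (ιs a) = ιs (αA a) := by
    intro a
    have e1 : ∀ a', ιs a' * α (ιs a) = ιs a' * ιs (αA a) := by
      intro a'
      apply W.injective
      rw [hrs, w3, ← map_mul, w3, hrsA, hM.rsmul_coe]
    refine eq_of_mul_left_all fun z => ?_
    refine eq_of_dense_span hds' (LinearMap.mulRight ℂ (α (ιs a)))
      (LinearMap.mulRight ℂ (ιs (αA a))) (continuous_id.mul continuous_const)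
      (continuous_id.mul continuous_const) ?_ z
    rintro _ ⟨c, a', rfl⟩
    rw [LinearMap.mulRight_apply, LinearMap.mulRight_apply, mul_assoc, mul_assoc, e1]
  refine ⟨α, ?_, ⟨Φ, ?_⟩, αA, hα, ΦA, hΦA⟩
  · ext c
    constructor
    · rintro ⟨_, ⟨a, rfl⟩, rfl⟩
      exact ⟨αA a, (hα a).symm⟩
    · rintro ⟨a, rfl⟩
      exact ⟨_, ⟨αA.symm a, rfl⟩, by rw [hα]; simp⟩
  · ext y
    rw [Submodule.mem_map]
    constructor
    · rintro ⟨c, hc, rfl⟩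
      obtain ⟨a, rfl⟩ := (rangeSub_mem ιs c).1 hc
      change Φ.toEquiv (ιs a) ∈ X
      rw [hΦ', w3]
      exact (V a).2
    · intro hy
      refine ⟨ιs (V.symm ⟨y, hy⟩), (rangeSub_mem ιs _).2 ⟨_, rfl⟩, ?_⟩
      change Φ.toEquiv _ = y
      rw [hΦ', w3]; simp

end Extend

lemma trivial_alpha {C : Type*} [NonUnitalCStarAlgebra C] [PartialOrder C] [StarOrderedRing C]
    (T : EquivBimodule C C C) (hT : IsTrivialData T) :
    IsAlphaData ⇑(StarAlgEquiv.refl ℂ C) ⇑(StarAlgEquiv.refl ℂ C).symm T :=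
  hT

lemma pair_iff {As Cs : Type*} [NonUnitalCStarAlgebra As]
    [NonUnitalCStarAlgebra Cs] [PartialOrder Cs] [StarOrderedRing Cs]
    (ιs : As →⋆ₙₐ[ℂ] Cs) (α β : Cs ≃⋆ₐ[ℂ] Cs)
    (Eα : EquivBimodule Cs Cs Cs) (ha : IsAlphaData ⇑α ⇑α.symm Eα)
    (Eβ : EquivBimodule Cs Cs Cs) (hb : IsAlphaData ⇑β ⇑β.symm Eβ) :
        (PairEquiv Eα (rangeSub ⇑ιs) Eβ (rangeSub ⇑ιs) ↔
          ∃ u : 𝓜(ℂ, Cs), u ∈ unitary 𝓜(ℂ, Cs) ∧ IsMultiplierOf ⇑ιs u ∧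
            ∀ c : Cs, α (β.symm c) = mAd u c) := by
  constructor
  · rintro ⟨Φ, hΦ⟩
    obtain ⟨u, hu, hus, huf, h⟩ := iso_to_mult α β Eα Eβ ha hb Φ
    refine ⟨u, hu, ⟨fun a => ?_, fun a => ?_⟩, h⟩
    · have : ιs (star a) ∈ rangeSub ⇑ιs := (rangeSub_mem ιs _).2 ⟨_, rfl⟩
      rw [← hΦ, Submodule.mem_map] at this
      obtain ⟨c, hc, hc'⟩ := this
      obtain ⟨b, rfl⟩ := (rangeSub_mem ιs _).1 hc
      change Φ.toEquiv (ιs b) = ιs (star a) at hc'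
      rw [huf, ← map_star ιs, ← hc', LinearEquiv.symm_apply_apply, ← map_star ιs]
      exact ⟨_, rfl⟩
    · have : Φ.toEquiv (ιs a) ∈ rangeSub ⇑ιs := by
        have h' : Φ.toEquiv (ιs a) ∈ (rangeSub ⇑ιs).map Φ.toEquiv.toLinearMap :=
          Submodule.mem_map.2 ⟨ιs a, (rangeSub_mem ιs _).2 ⟨_, rfl⟩, rfl⟩
        rwa [hΦ] at h'
      rw [hus]
      exact (rangeSub_mem ιs _).1 this
  · rintro ⟨u, hu, hm, h⟩
    obtain ⟨Φ, hf, hs⟩ := mult_to_iso α β Eα Eβ ha hb u hu h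
    refine ⟨Φ, ?_⟩
    ext y
    rw [Submodule.mem_map]
    constructor
    · rintro ⟨c, hc, rfl⟩
      obtain ⟨a, rfl⟩ := (rangeSub_mem ιs _).1 hc
      change Φ.toEquiv (ιs a) ∈ _
      rw [hf]
      exact (rangeSub_mem ιs _).2 (hm.2 a)
    · intro hy
      obtain ⟨a, rfl⟩ := (rangeSub_mem ιs _).1 hy
      refine ⟨Φ.toEquiv.symm (ιs a), ?_, ?_⟩
      · rw [hs, mult_star_snd, ← map_star ιs]
        obtain ⟨b, hb⟩ := hm.1 (star a)
        rw [← hb, ← map_star ιs]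
        exact (rangeSub_mem ιs _).2 ⟨_, rfl⟩
      · change Φ.toEquiv _ = _
        rw [LinearEquiv.apply_symm_apply]

lemma alpha_iff {C : Type*} [NonUnitalCStarAlgebra C] [PartialOrder C] [StarOrderedRing C]
    (α β : C ≃⋆ₐ[ℂ] C) (Ea Eb : EquivBimodule C C C)
    (ha : IsAlphaData ⇑α ⇑α.symm Ea) (hb : IsAlphaData ⇑β ⇑β.symm Eb) :
    Nonempty (Ea.Iso Eb) ↔ ∃ u : 𝓜(ℂ, C), u ∈ unitary 𝓜(ℂ, C) ∧
      ∀ c, α (β.symm c) = mAd u c := by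
  constructor
  · rintro ⟨Φ⟩
    obtain ⟨u, hu, -, -, h⟩ := iso_to_mult α β Ea Eb ha hb Φ
    exact ⟨u, hu, h⟩
  · rintro ⟨u, hu, h⟩
    obtain ⟨Φ, -⟩ := mult_to_iso α β Ea Eb ha hb u hu h
    exact ⟨Φ⟩

lemma stable_cyclic {A C As Cs X : Type*}
    [NonUnitalCStarAlgebra A] [PartialOrder A] [StarOrderedRing A]
    [NonUnitalCStarAlgebra C]
    [NonUnitalCStarAlgebra As] [PartialOrder As] [StarOrderedRing As]
    [NonUnitalCStarAlgebra Cs]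
    (ι : A →⋆ₙₐ[ℂ] C) (hι : Function.Injective ι) (hσ : SigmaUnital A)
    (e : ℕ → ℕ → C → Cs) (hstab : IsStabilization e)
    (ιs : As →⋆ₙₐ[ℂ] Cs) (hιs : Function.Injective ιs)
    (hAs : Set.range ⇑ιs =
      closure (Submodule.span ℂ {x : Cs | ∃ i j a, x = e i j (ι a)} : Set Cs))
    [NormedAddCommGroup X] [NormedSpace ℂ X] [CompleteSpace X]
    (M : EquivBimodule As As X) :
    ∃ V : As ≃ₗ[ℂ] X, (∀ a b, V (a * b) = M.lsmul a (V b)) ∧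
      ∀ a b, M.linn (V a) (V b) = a * star b := by
  have hiso : Isometry ιs := NonUnitalStarAlgHom.isometry ιs hιs
  have hmem : ∀ i j a, ∃ b : As, ιs b = e i j (ι a) := by
    intro i j a
    have : e i j (ι a) ∈ Set.range ⇑ιs := by
      rw [hAs]; exact subset_closure (Submodule.subset_span ⟨i, j, a, rfl⟩)
    exact this
  choose E hE using hmem
  obtain ⟨h, h0, hl⟩ := hσ
  have hsa : star h = h := h0.isSelfAdjoint
  have hr : DenseRange fun a => a * h := by
    have h3 : DenseRange (fun a => star (h * star a)) := by
      have e1 : Function.Surjective (star : A → A) := star_involutive.surjective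
      exact (e1.denseRange.comp hl continuous_star).comp e1.denseRange
        (continuous_star.comp (continuous_const.mul continuous_id))
    simpa [hsa] using h3
  obtain ⟨t, t1, t2⟩ := exists_cyclic M E (by
      intro i j k l a b
      apply hιs
      rw [map_mul, hE, hE, hstab.map_mul]
      split_ifs
      · rw [hE, map_mul]
      · rw [map_zero])
    (by
      intro i j
      have hι' : Isometry ι := NonUnitalStarAlgHom.isometry ι hι
      rw [hiso.isEmbedding.continuous_iff]
      have : ⇑ιs ∘ E i j = e i j ∘ ι := funext fun a => hE i j a
      rw [this]
      refine Continuous.comp ?_ hι'.continuous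
      let L : C →ₗ[ℂ] Cs := ⟨⟨e i j, hstab.map_add i j⟩, hstab.map_smul i j⟩
      exact (L.mkContinuous 1 (fun c => by rw [one_mul]; exact (hstab.isometry i j c).le)).continuous)
    (by
      intro b
      rw [hiso.isEmbedding.isInducing.closure_eq_preimage_closure_image]
      change ιs b ∈ closure _
      have hb : ιs b ∈ Set.range ⇑ιs := ⟨b, rfl⟩
      rw [hAs] at hb
      refine closure_mono ?_ hb
      have : Submodule.span ℂ {x : Cs | ∃ i j a, x = e i j (ι a)} ≤
          (Submodule.span ℂ {b : As | ∃ i j a, b = E i j a}).map (ιs : As →ₗ[ℂ] Cs) := by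
        rw [Submodule.span_le]
        rintro _ ⟨i, j, a, rfl⟩
        exact ⟨E i j a, Submodule.subset_span ⟨i, j, a, rfl⟩, hE i j a⟩
      exact this)
    h hl hr
  exact exists_unitary M t t1 t2

/-- For the stabilized inclusion `A^s ⊆ C^s` (with `A` σ-unital and `AC`
dense in `C`) and `f_{A^s} : Pic(A^s, C^s) → Pic(A^s)`, `[X,Y] ↦ [X]`:
(i) `1 → Ker f_{A^s} → Pic(A^s, C^s) → Im f_{A^s} → 1` is exact;
(ii) `Ker f_{A^s} ≅ Aut_I(A^s, C^s)/Int(A^s, C^s)`;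
(iii) `Im f_{A^s} ≅ Aut(A^s, C^s)/Aut_I(A^s, C^s)`;
here these isomorphisms are induced by `π(α) = [X_α, Y_α]` and `α ↦ [X_α]`. -/
theorem stabilized_kernel_image_fA
    {A C As Cs : Type*}
    [NonUnitalCStarAlgebra A] [PartialOrder A] [StarOrderedRing A]
    [NonUnitalCStarAlgebra C] [PartialOrder C] [StarOrderedRing C]
    [NonUnitalCStarAlgebra As] [PartialOrder As] [StarOrderedRing As]
    [NonUnitalCStarAlgebra Cs] [PartialOrder Cs] [StarOrderedRing Cs]
    (ι : A →⋆ₙₐ[ℂ] C) (hι : Function.Injective ι) (hd : DenseIncl ⇑ι)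
    (hσ : SigmaUnital A)
    (e : ℕ → ℕ → C → Cs) (hstab : IsStabilization e)
    (ιs : As →⋆ₙₐ[ℂ] Cs) (hιs : Function.Injective ιs) (hds : DenseIncl ⇑ιs)
    (hAs : Set.range ⇑ιs =
      closure (Submodule.span ℂ {x : Cs | ∃ i j a, x = e i j (ι a)} : Set Cs)) :
    -- (ii.a) for `α ∈ Aut(A^s, C^s)` (with restriction `αA`), `π(α) ∈ Ker f_{A^s}`
    -- iff `α ∈ Aut_I(A^s, C^s)`
    (∀ (α : Cs ≃⋆ₐ[ℂ] Cs), ⇑α '' Set.range ⇑ιs = Set.range ⇑ιs →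
      ∀ (αA : As ≃⋆ₐ[ℂ] As), (∀ a : As, α (ιs a) = ιs (αA a)) →
      ∀ (EαA : EquivBimodule As As As), IsAlphaData ⇑αA ⇑αA.symm EαA →
      ∀ (TA : EquivBimodule As As As), IsTrivialData TA →
        (Nonempty (EαA.Iso TA) ↔
          ∃ u : 𝓜(ℂ, As), u ∈ unitary 𝓜(ℂ, As) ∧ ∀ a : As, αA a = mAd u a)) ∧
    -- (ii.b) every element of `Ker f_{A^s}` is `π(α)` for some `α ∈ Aut_I(A^s, C^s)`
    (∀ (Yt : Type*) [NormedAddCommGroup Yt] [NormedSpace ℂ Yt] [CompleteSpace Yt]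
      (F : EquivBimodule Cs Cs Yt) (X : Submodule ℂ Yt) [CompleteSpace X]
      (MX : EquivBimodule As As X), IsEquiPair ⇑ιs F X → IsRestriction ⇑ιs ⇑ιs F X MX →
      ∀ (TA : EquivBimodule As As As), IsTrivialData TA → Nonempty (MX.Iso TA) →
        ∃ (α : Cs ≃⋆ₐ[ℂ] Cs), ⇑α '' Set.range ⇑ιs = Set.range ⇑ιs ∧
          (∃ (αA : As ≃⋆ₐ[ℂ] As), (∀ a : As, α (ιs a) = ιs (αA a)) ∧
            ∃ u : 𝓜(ℂ, As), u ∈ unitary 𝓜(ℂ, As) ∧ ∀ a : As, αA a = mAd u a) ∧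
          ∃ (Eα : EquivBimodule Cs Cs Cs), IsAlphaData ⇑α ⇑α.symm Eα ∧
            PairEquiv Eα (rangeSub ⇑ιs) F X) ∧
    -- (ii.c) `π(α) = π(β)` iff `α ∘ β⁻¹ ∈ Int(A^s, C^s)`: together with (ii.a) and
    -- (ii.b) this gives `Ker f_{A^s} ≅ Aut_I(A^s, C^s)/Int(A^s, C^s)`
    (∀ (α β : Cs ≃⋆ₐ[ℂ] Cs), ⇑α '' Set.range ⇑ιs = Set.range ⇑ιs →
      ⇑β '' Set.range ⇑ιs = Set.range ⇑ιs →
      ∀ (Eα : EquivBimodule Cs Cs Cs), IsAlphaData ⇑α ⇑α.symm Eα →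
      ∀ (Eβ : EquivBimodule Cs Cs Cs), IsAlphaData ⇑β ⇑β.symm Eβ →
        (PairEquiv Eα (rangeSub ⇑ιs) Eβ (rangeSub ⇑ιs) ↔
          ∃ u : 𝓜(ℂ, Cs), u ∈ unitary 𝓜(ℂ, Cs) ∧ IsMultiplierOf ⇑ιs u ∧
            ∀ c : Cs, α (β.symm c) = mAd u c)) ∧
    -- (iii.a) every element of `Im f_{A^s}` is of the form `[X_α]`
    (∀ (Yt : Type*) [NormedAddCommGroup Yt] [NormedSpace ℂ Yt] [CompleteSpace Yt]
      (F : EquivBimodule Cs Cs Yt) (X : Submodule ℂ Yt) [CompleteSpace X]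
      (MX : EquivBimodule As As X), IsEquiPair ⇑ιs F X → IsRestriction ⇑ιs ⇑ιs F X MX →
        ∃ (α : Cs ≃⋆ₐ[ℂ] Cs), ⇑α '' Set.range ⇑ιs = Set.range ⇑ιs ∧
          ∃ (αA : As ≃⋆ₐ[ℂ] As), (∀ a : As, α (ιs a) = ιs (αA a)) ∧
            ∃ (EαA : EquivBimodule As As As), IsAlphaData ⇑αA ⇑αA.symm EαA ∧
              Nonempty (MX.Iso EαA)) ∧
    -- (iii.b) `[X_α] = [X_β]` in `Pic(A^s)` iff `α ∘ β⁻¹ ∈ Aut_I(A^s, C^s)`: together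
    -- with (iii.a) this gives `Im f_{A^s} ≅ Aut(A^s, C^s)/Aut_I(A^s, C^s)`
    (∀ (α β : Cs ≃⋆ₐ[ℂ] Cs), ⇑α '' Set.range ⇑ιs = Set.range ⇑ιs →
      ⇑β '' Set.range ⇑ιs = Set.range ⇑ιs →
      ∀ (αA βA : As ≃⋆ₐ[ℂ] As), (∀ a : As, α (ιs a) = ιs (αA a)) →
        (∀ a : As, β (ιs a) = ιs (βA a)) →
      ∀ (EαA : EquivBimodule As As As), IsAlphaData ⇑αA ⇑αA.symm EαA →
      ∀ (EβA : EquivBimodule As As As), IsAlphaData ⇑βA ⇑βA.symm EβA →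
        (Nonempty (EαA.Iso EβA) ↔
          ∃ u : 𝓜(ℂ, As), u ∈ unitary 𝓜(ℂ, As) ∧
            ∀ a : As, αA (βA.symm a) = mAd u a)) := by
  refine ⟨?_, ?_, ?_, ?_, ?_⟩
  · intro α _ αA _ EαA hEα TA hTA
    exact alpha_iff αA (StarAlgEquiv.refl ℂ As) EαA TA hEα (trivial_alpha TA hTA)
  · intro Yt _ _ _ F X _ MX hE hM TA hTA hΨ
    obtain ⟨Ψ⟩ := hΨ
    have v1 : ∀ a b, Ψ.toEquiv.symm (a * b) = MX.lsmul a (Ψ.toEquiv.symm b) := fun a b => by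
      have := Ψ.symm.map_lsmul a b
      rw [hTA.1] at this
      exact this
    have v2 : ∀ a b, MX.linn (Ψ.toEquiv.symm a) (Ψ.toEquiv.symm b) = a * star b :=
      fun a b => by
        have := Ψ.symm.map_linn a b
        rw [hTA.2.2.1] at this
        exact this
    obtain ⟨α, hα, hP, αA, hαA, Φ, -⟩ := extend_pair ιs hιs hds F X MX hE hM Ψ.toEquiv.symm v1 v2
    refine ⟨α, hα, ⟨αA, hαA, ?_⟩, EquivBimodule.alphaBimodule α,
      EquivBimodule.alphaBimodule_data α, hP⟩
    exact (alpha_iff αA (StarAlgEquiv.refl ℂ As) _ TA (EquivBimodule.alphaBimodule_data αA)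
      (trivial_alpha TA hTA)).1 ⟨Φ.trans Ψ⟩
  · intro α β _ _ Eα hEα Eβ hEβ
    exact pair_iff ιs α β Eα hEα Eβ hEβ
  · intro Yt _ _ _ F X _ MX hE hM
    obtain ⟨V, v1, v2⟩ := stable_cyclic ι hι hσ e hstab ιs hιs hAs MX
    obtain ⟨α, hα, -, αA, hαA, Φ, -⟩ := extend_pair ιs hιs hds F X MX hE hM V v1 v2
    exact ⟨α, hα, αA, hαA, EquivBimodule.alphaBimodule αA,
      EquivBimodule.alphaBimodule_data αA, ⟨Φ.symm⟩⟩
  · intro α β _ _ αA βA _ _ EαA hEα EβA hEβ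
    exact alpha_iff αA βA EαA EβA hEα hEβ

end
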